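/- arXiv:1510.02570 — 3 statements merged into one kernel-verified Lean document; each statement's English description precedes it below -/
import Mathlib

section
/- Let α, β be real numbers, let m1, m2 ≥ 0 be integers with m = m1+m2 ≥ 1, and let Y_1, …, Y_m be nonzero real polynomials with deg Y_i = u_i and leading coefficient r_i. Assume u_1, …, u_{m1} are pairwise distinct and u_{m1+1}, …, u_m are pairwise distinct. Let D(x) be the determinant of the m×m matrix whose (i,j) entry, for j = 1,…,m, equals N1^{α;m−j}_{x−j}·N2^{β;j−1}_{x−1}·Y_i(θ_{x−j}) when i = 1,…,m1 and equals Y_i(θ_{x−j}) when i = m1+1,…,m. Then the polynomial P(x) = D(x)/(p(x)q(x)) has degree exactly d = 2(u_1 + ⋯ + u_m) − 2( m1(m1−1)/2 + m2(m2−1)/2 ), and its leading coefficient equals V(u_1,…,u_{m1})·V(u_{m1+1},…,u_m)·Π_{i=1}^{m} r_i, where V(x_1,…,x_K) = Π_{1≤i<j≤K}(x_j − x_i) is the Vandermonde determinant (V of a 0- or 1-tuple being 1). -/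
open Polynomial

/-- Pochhammer-type product `(a)_k` for a polynomial argument `a`. -/
noncomputable def pochPoly (a : Polynomial ℝ) (k : ℕ) : Polynomial ℝ :=
  ∏ i ∈ Finset.range k, (a + (i : Polynomial ℝ))

namespace lgp

variable (m1 m2 : ℕ) (α β : ℝ)

/-- `θ_x = x(x+α+β+1)` as a polynomial. -/
noncomputable def θpoly : Polynomial ℝ := X * (X + C (α + β + 1))

/-- The `(i,j)` entry (1-indexed) of the matrix in Lemma A.1:
`N1^{α;m-j}_{x-j} N2^{β;j-1}_{x-1} Y_i(θ_{x-j})` for `i ≤ m1` and `Y_i(θ_{x-j})` else. -/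
noncomputable def entry (Y : ℕ → Polynomial ℝ) (i j : ℕ) : Polynomial ℝ :=
  (if i ≤ m1 then
    C ((-1 : ℝ) ^ ((m1 + m2) - j)) *
      pochPoly (X + C (α - ((m1 + m2 : ℕ) : ℝ) + 1)) ((m1 + m2) - j) *
      pochPoly (X + C (β + 1 - (j : ℝ))) (j - 1)
  else 1) * (Y i).comp ((θpoly α β).comp (X - C (j : ℝ)))

/-- The determinant `D(x)` of Lemma A.1, as a polynomial. -/
noncomputable def Dpoly (Y : ℕ → Polynomial ℝ) : Polynomial ℝ :=
  Matrix.det (Matrix.of fun i j : Fin (m1 + m2) =>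
    entry m1 m2 α β Y ((i : ℕ) + 1) ((j : ℕ) + 1))

/-- The polynomial `p(x)` of the paper. -/
noncomputable def ppoly : Polynomial ℝ :=
  ∏ i ∈ Finset.Icc 1 (m1 - 1),
    C ((-1 : ℝ) ^ (m1 - i)) * pochPoly (X + C (α - ((m1 + m2 : ℕ) : ℝ) + 1)) (m1 - i) *
      pochPoly (X + C (β - (m1 : ℝ) + (i : ℝ))) (m1 - i)

/-- The polynomial `q(x)` of the paper. -/
noncomputable def qpoly : Polynomial ℝ :=
  C ((-1 : ℝ) ^ ((m1 + m2) * (m1 + m2 - 1) / 2)) *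
    ∏ h ∈ Finset.Icc 1 (m1 + m2 - 1), ∏ i ∈ Finset.Icc 1 h,
      (2 * (X - C ((m1 + m2 : ℕ) : ℝ)) + C (α + β + (i : ℝ) + (h : ℝ)))

end lgp

open lgp


section PartA

open Finset

theorem prod_coeff_of_le {ι : Type*} (s : Finset ι) (f : ι → ℝ[X]) (ρ : ι → ℕ)
    (h : ∀ i ∈ s, (f i).natDegree ≤ ρ i) :
    (∏ i ∈ s, f i).natDegree ≤ ∑ i ∈ s, ρ i ∧
    (∏ i ∈ s, f i).coeff (∑ i ∈ s, ρ i) = ∏ i ∈ s, (f i).coeff (ρ i) := by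
  classical
  induction s using Finset.induction_on with
  | empty => simp
  | insert a s ha ih =>
    have h1 := ih (fun i hi => h i (mem_insert_of_mem hi))
    have h2 := h a (mem_insert_self _ _)
    rw [prod_insert ha, sum_insert ha, prod_insert ha]
    refine ⟨natDegree_mul_le.trans (add_le_add h2 h1.1), ?_⟩
    rw [coeff_mul_add_eq_of_natDegree_le h2 h1.1, h1.2]

theorem det_coeff_of_le {ι : Type*} [Fintype ι] [DecidableEq ι] (A : Matrix ι ι ℝ[X]) (ρ : ι → ℕ)
    (h : ∀ i j, (A i j).natDegree ≤ ρ i) :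
    A.det.natDegree ≤ ∑ i, ρ i ∧
    A.det.coeff (∑ i, ρ i) = (Matrix.of fun i j => (A i j).coeff (ρ i)).det := by
  rw [← Matrix.det_transpose, ← Matrix.det_transpose (Matrix.of fun i j => (A i j).coeff (ρ i)),
    Matrix.det_apply, Matrix.det_apply]
  have key : ∀ σ : Equiv.Perm ι, _ := fun σ =>
    prod_coeff_of_le univ (fun i => A.transpose (σ i) i) ρ (fun i _ => h _ _)
  constructor
  · apply natDegree_sum_le_of_forall_le
    intro σ _
    exact (natDegree_smul_le _ _).trans (key σ).1
  · rw [finsetSum_coeff]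
    refine sum_congr rfl fun σ _ => ?_
    rcases Int.units_eq_one_or (Equiv.Perm.sign σ) with h | h <;>
      · have := (key σ).2
        simp only [Matrix.transpose_apply] at this
        simp [h, this]

theorem swap_coeff_coeff (p : ℝ[X][X]) (n k : ℕ) :
    ((Bivariate.swap p).coeff k).coeff n = (p.coeff n).coeff k := by
  induction p using Polynomial.induction_on' with
  | add p q hp hq => simp [hp, hq]
  | monomial l a =>
    induction a using Polynomial.induction_on' with
    | add p q hp hq => simp only [map_add, coeff_add, hp, hq]
    | monomial i r =>
      rw [Bivariate.swap_monomial_monomial]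
      simp only [coeff_monomial]
      split_ifs <;> simp_all [coeff_monomial]

/-- homogenising substitution `z ↦ x y`. -/
noncomputable def Thom (F : ℝ[X][X]) : ℝ[X][X] := Bivariate.swap (F.comp (C X * X))

/-- `F(x,z)` has total degree `≤ d` and top part with symbol `S`. -/
def TD (F : ℝ[X][X]) (d : ℕ) (S : ℝ[X]) : Prop :=
  (Thom F).natDegree ≤ d ∧ (Thom F).coeff d = S

theorem Thom_mul (F G) : Thom (F * G) = Thom F * Thom G := by simp [Thom]
theorem Thom_add (F G) : Thom (F + G) = Thom F + Thom G := by simp [Thom]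
theorem Thom_coeff (F : ℝ[X][X]) (k n : ℕ) :
    ((Thom F).coeff k).coeff n = (F.coeff n * X ^ n).coeff k := by
  rw [Thom, swap_coeff_coeff, comp_C_mul_X_coeff]

theorem TD.mul {F G d e S T} (h : TD F d S) (h' : TD G e T) : TD (F * G) (d + e) (S * T) := by
  refine ⟨?_, ?_⟩
  · rw [Thom_mul]; exact natDegree_mul_le.trans (add_le_add h.1 h'.1)
  · rw [Thom_mul, coeff_mul_add_eq_of_natDegree_le h.1 h'.1, h.2, h'.2]

theorem TD.add {F G d S T} (h : TD F d S) (h' : TD G d T) : TD (F + G) d (S + T) := by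
  refine ⟨?_, ?_⟩
  · rw [Thom_add]; exact natDegree_add_le_of_degree_le h.1 h'.1
  · rw [Thom_add, coeff_add, h.2, h'.2]

theorem TD.one : TD 1 0 1 := by
  constructor <;> simp [Thom]

theorem TD.zero (d) : TD 0 d 0 := by
  constructor <;> simp [Thom]

theorem TD.const (r : ℝ) : TD (C (C r)) 0 (C r) := by
  constructor <;> simp [Thom, Bivariate.swap_C_C]

theorem TD.varX : TD (C X) 1 1 := by
  constructor <;> simp [Thom, Bivariate.swap_X]

theorem TD.varZ : TD X 1 X := by
  have : Thom Polynomial.X = Polynomial.X * C Polynomial.X := by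
    simp [Thom, Bivariate.swap_X, Bivariate.swap_Y]
  constructor
  · rw [this]; compute_degree
  · rw [this]; simp

theorem TD.succ {F d S} (h : TD F d S) : TD F (d + 1) 0 := by
  refine ⟨h.1.trans (Nat.le_succ _), coeff_eq_zero_of_natDegree_lt (Nat.lt_succ_of_le h.1)⟩

theorem TD.of_lt {F d S e} (h : TD F d S) (he : d < e) : TD F e 0 := by
  refine ⟨h.1.trans he.le, coeff_eq_zero_of_natDegree_lt (lt_of_le_of_lt h.1 he)⟩

theorem TD.pow {F d S} (h : TD F d S) (n : ℕ) : TD (F ^ n) (n * d) (S ^ n) := by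
  induction n with
  | zero => simpa using TD.one
  | succ n ih => rw [pow_succ, pow_succ, Nat.succ_mul]; exact ih.mul h

theorem TD.sum {ι : Type*} (s : Finset ι) {F : ι → ℝ[X][X]} {d} {S : ι → ℝ[X]}
    (h : ∀ i ∈ s, TD (F i) d (S i)) : TD (∑ i ∈ s, F i) d (∑ i ∈ s, S i) := by
  classical
  induction s using Finset.induction_on with
  | empty => simpa using TD.zero d
  | insert a s ha ih =>
    rw [sum_insert ha, sum_insert ha]
    exact (h a (mem_insert_self _ _)).add (ih fun i hi => h i (mem_insert_of_mem hi))

theorem TD.coeff_zero {F d S} (h : TD F d S) {n k : ℕ} (hk : d < n + k) :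
    (F.coeff n).coeff k = 0 := by
  have := Thom_coeff F (k + n) n
  rw [coeff_mul_X_pow, coeff_eq_zero_of_natDegree_lt (lt_of_le_of_lt h.1 (by omega))] at this
  simpa using this.symm

theorem TD.coeff_top {F d S} (h : TD F d S) {n k : ℕ} (hk : n + k = d) :
    (F.coeff n).coeff k = S.coeff n := by
  have := Thom_coeff F (k + n) n
  rw [coeff_mul_X_pow] at this
  rw [← this, ← h.2, add_comm k, hk]

theorem TD.symb_zero {F d S} (h : TD F d S) {n : ℕ} (hk : d < n) : S.coeff n = 0 := by
  have := Thom_coeff F d n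
  rw [h.2, coeff_mul_X_pow', if_neg (by omega)] at this
  exact this

/-- functional applied to the rows -/
theorem TD.functional {F d S} (h : TD F d S) (lam : ℕ → ℝ) (ω K N : ℕ)
    (hN : F.natDegree < N)
    (hlam : ∀ n, lam n ≠ 0 → ω ≤ n + K) :
    (Polynomial.X ^ ω * ∑ n ∈ range N, F.coeff n * C (lam n)).natDegree ≤ d + K ∧
    (Polynomial.X ^ ω * ∑ n ∈ range N, F.coeff n * C (lam n)).coeff (d + K) =
      if K ≤ ω then S.coeff (ω - K) * lam (ω - K) else 0 := by
  constructor
  · rw [natDegree_le_iff_coeff_eq_zero]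
    intro e he
    rw [coeff_X_pow_mul']
    split_ifs with hω
    · rw [finsetSum_coeff]
      refine sum_eq_zero fun n _ => ?_
      rw [coeff_mul_C]
      by_cases hn : lam n = 0
      · simp [hn]
      · have := hlam n hn
        rw [h.coeff_zero (by omega), zero_mul]
    · rfl
  · rw [coeff_X_pow_mul']
    split_ifs with h1 h2 h2
    · rw [finsetSum_coeff]
      rw [sum_eq_single (ω - K)]
      · rw [coeff_mul_C, h.coeff_top (by omega)]
      · intro n _ hne
        rw [coeff_mul_C]
        by_cases hn : lam n = 0
        · simp [hn]
        · have := hlam n hn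
          rw [h.coeff_zero (by omega), zero_mul]
      · intro hn
        rw [mem_range, not_lt] at hn
        rw [coeff_eq_zero_of_natDegree_lt (p := F) (by omega)]
        simp
    · rw [finsetSum_coeff]
      refine sum_eq_zero fun n _ => ?_
      rw [coeff_mul_C]
      by_cases hn : lam n = 0
      · simp [hn]
      · have := hlam n hn
        rw [h.coeff_zero (by omega), zero_mul]
    · rw [h.symb_zero (by omega), zero_mul]
    · rfl

end PartA



section PartB

open Finset

/-- the Euler operator -/
noncomputable def eul (p : ℝ[X]) : ℝ[X] := X * derivative p

theorem eul_coeff (p : ℝ[X]) (n : ℕ) : (eul p).coeff n = n * p.coeff n := by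
  cases n with
  | zero => simp [eul]
  | succ n => rw [eul, coeff_X_mul, coeff_derivative]; push_cast; ring

theorem eul_iter_coeff (a : ℕ) (p : ℝ[X]) (n : ℕ) : (eul^[a] p).coeff n = (n : ℝ) ^ a * p.coeff n := by
  induction a with
  | zero => simp
  | succ a ih => rw [Function.iterate_succ_apply', eul_coeff, ih]; ring

theorem eul_iter_natDegree (a : ℕ) (p : ℝ[X]) : (eul^[a] p).natDegree ≤ p.natDegree := by
  rw [natDegree_le_iff_coeff_eq_zero]
  intro N hN
  rw [eul_iter_coeff, coeff_eq_zero_of_natDegree_lt hN, mul_zero]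

theorem eul_iter_pow (e : ℝ) (a : ℕ) : ∀ (s : ℕ) (r : ℝ[X]), ∃ r' : ℝ[X],
    eul^[a] ((X - C e) ^ (a + s) * r) = (X - C e) ^ s * r' ∧
    r'.eval e * (s.factorial : ℝ) = ((a + s).factorial : ℝ) * e ^ a * r.eval e := by
  induction a with
  | zero => intro s r; exact ⟨r, by simp, by simp [mul_comm]⟩
  | succ a ih =>
    intro s r
    obtain ⟨r', h1, h2⟩ := ih (s + 1) r
    refine ⟨X * (((s : ℝ[X]) + 1) * r' + (X - C e) * derivative r'), ?_, ?_⟩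
    · rw [Function.iterate_succ_apply', show a + 1 + s = a + (s + 1) by ring, h1, eul]
      simp only [derivative_mul, derivative_pow_succ, derivative_sub, derivative_X, derivative_C]
      simp only [map_add, map_natCast, map_one]
      ring
    · rw [show a + 1 + s = a + (s + 1) by ring]
      rw [Nat.factorial_succ s] at h2
      push_cast at h2
      simp
      linear_combination e * h2

theorem sum_functional (e : ℝ) (a m : ℕ) (p : ℝ[X]) (hp : p.natDegree < m) :
    ∑ j : Fin m, e ^ (j : ℕ) * (j : ℝ) ^ a * p.coeff j = (eul^[a] p).eval e := by
  rw [eval_eq_sum_range' (lt_of_le_of_lt (eul_iter_natDegree a p) hp), ← Fin.sum_univ_eq_sum_range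
    (fun i => (eul^[a] p).coeff i * e ^ i)]
  refine sum_congr rfl fun j _ => ?_
  rw [eul_iter_coeff]; ring

/-- confluent Vandermonde -/
noncomputable def Wmat (m1 m2 : ℕ) : Matrix (Fin m1 ⊕ Fin m2) (Fin m1 ⊕ Fin m2) ℝ :=
  Matrix.of fun k j => Sum.elim
    (fun a : Fin m1 => (-1 : ℝ) ^ (finSumFinEquiv j : ℕ) * ((finSumFinEquiv j : ℕ) : ℝ) ^ (a : ℕ))
    (fun b : Fin m2 => ((finSumFinEquiv j : ℕ) : ℝ) ^ (b : ℕ)) k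

/-- auxiliary basis -/
noncomputable def bpol (m1 m2 : ℕ) (k : Fin m1 ⊕ Fin m2) : ℝ[X] :=
  Sum.elim (fun a : Fin m1 => (X - C (-1)) ^ (a : ℕ))
    (fun b : Fin m2 => (X - C (-1)) ^ m1 * (X - C 1) ^ (b : ℕ)) k

theorem bpol_monic (m1 m2 k) : (bpol m1 m2 k).Monic := by
  rcases k with a | b
  · exact (monic_X_sub_C _).pow _
  · exact ((monic_X_sub_C _).pow _).mul ((monic_X_sub_C _).pow _)

theorem bpol_natDegree (m1 m2 k) : (bpol m1 m2 k).natDegree = (finSumFinEquiv k : ℕ) := by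
  rcases k with a | b
  · simp only [bpol, Sum.elim_inl, natDegree_pow, natDegree_X_sub_C]; simp
  · simp only [bpol, Sum.elim_inr]
    rw [((monic_X_sub_C _).pow _).natDegree_mul ((monic_X_sub_C _).pow _)]
    simp only [natDegree_pow, natDegree_X_sub_C]; simp

theorem det_bpol (m1 m2) : (Matrix.of fun i j : Fin m1 ⊕ Fin m2 =>
    (bpol m1 m2 j).coeff (finSumFinEquiv i : ℕ)).det = 1 := by
  have := Matrix.det_matrixOfPolynomials (fun i : Fin (m1 + m2) => bpol m1 m2 (finSumFinEquiv.symm i))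
    (fun i => by rw [bpol_natDegree]; simp) (fun i => bpol_monic _ _ _)
  rw [← Matrix.det_submatrix_equiv_self finSumFinEquiv] at this
  rw [← this]
  congr 1
  ext i j
  simp

theorem W_mul (m1 m2) (k j) : (Wmat m1 m2 * Matrix.of fun i j : Fin m1 ⊕ Fin m2 =>
    (bpol m1 m2 j).coeff (finSumFinEquiv i : ℕ)) k j =
    Sum.elim (fun a : Fin m1 => (eul^[(a : ℕ)] (bpol m1 m2 j)).eval (-1))
      (fun b : Fin m2 => (eul^[(b : ℕ)] (bpol m1 m2 j)).eval 1) k := by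
  have hd : (bpol m1 m2 j).natDegree < m1 + m2 := by rw [bpol_natDegree]; exact Fin.is_lt _
  rw [Matrix.mul_apply]
  rcases k with a | b
  · simp only [Sum.elim_inl]
    rw [← sum_functional (-1) a (m1 + m2) _ hd, ← Equiv.sum_comp finSumFinEquiv]
    rfl
  · simp only [Sum.elim_inr]
    rw [← sum_functional 1 b (m1 + m2) _ hd, ← Equiv.sum_comp finSumFinEquiv]
    simp only [one_pow, one_mul]
    rfl

theorem det_Wmat (m1 m2 : ℕ) : (Wmat m1 m2).det =
    (∏ a : Fin m1, (((a : ℕ).factorial : ℝ) * (-1) ^ (a : ℕ))) *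
    (∏ b : Fin m2, (((b : ℕ).factorial : ℝ) * 2 ^ m1)) := by
  have h1 : (Wmat m1 m2).det = (Wmat m1 m2 * Matrix.of fun i j : Fin m1 ⊕ Fin m2 =>
    (bpol m1 m2 j).coeff (finSumFinEquiv i : ℕ)).det := by
    rw [Matrix.det_mul, det_bpol, mul_one]
  set Q := (Wmat m1 m2 * Matrix.of fun i j : Fin m1 ⊕ Fin m2 =>
    (bpol m1 m2 j).coeff (finSumFinEquiv i : ℕ)) with hQ
  have hQe := W_mul m1 m2
  rw [← hQ] at hQe
  have key0 : ∀ (e : ℝ) (a a' : ℕ) (r : ℝ[X]), a < a' →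
      (eul^[a] ((X - C e) ^ a' * r)).eval e = 0 := by
    intro e a a' r h
    obtain ⟨s, rfl⟩ := Nat.exists_eq_add_of_lt h
    obtain ⟨r', h1, -⟩ := eul_iter_pow e a (s + 1) r
    rw [add_assoc, h1]; simp
  have key1 : ∀ (e : ℝ) (a : ℕ) (r : ℝ[X]),
      (eul^[a] ((X - C e) ^ a * r)).eval e = (a.factorial : ℝ) * e ^ a * r.eval e := by
    intro e a r
    obtain ⟨r', h1, h2⟩ := eul_iter_pow e a 0 r
    rw [add_zero] at h1 h2
    rw [h1, ← h2]; simp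
  have hb : Q = Matrix.fromBlocks Q.toBlocks₁₁ 0 Q.toBlocks₂₁ Q.toBlocks₂₂ := by
    rw [Matrix.ext_iff_blocks]
    refine ⟨by simp, ?_, by simp, by simp⟩
    ext a b
    simp only [Matrix.toBlocks_fromBlocks₁₂, Matrix.toBlocks₁₂, Matrix.of_apply, Matrix.zero_apply]
    rw [hQe]
    exact key0 _ _ _ _ a.2
  rw [h1, hb, Matrix.det_fromBlocks_zero₁₂, Matrix.det_of_isLowerTriangular,
    Matrix.det_of_isLowerTriangular]
  · congr 1
    · refine prod_congr rfl fun a _ => ?_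
      simp only [Matrix.toBlocks₁₁, Matrix.of_apply]
      rw [hQe]
      have := key1 (-1) a 1
      simp only [mul_one, eval_one] at this
      exact this
    · refine prod_congr rfl fun b _ => ?_
      simp only [Matrix.toBlocks₂₂, Matrix.of_apply]
      rw [hQe]
      have := key1 1 b ((X - C (-1)) ^ m1)
      simp only [Sum.elim_inr, bpol]
      rw [mul_comm, this]
      norm_num
  · intro b b' h
    simp only [Matrix.toBlocks₂₂, Matrix.of_apply]
    rw [hQe]
    simp only [Sum.elim_inr, bpol]
    rw [mul_comm]
    exact key0 _ _ _ _ (by simpa using h)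
  · intro b b' h
    simp only [Matrix.toBlocks₁₁, Matrix.of_apply]
    rw [hQe]
    simp only [Sum.elim_inl, bpol]
    rw [← mul_one ((X - C (-1 : ℝ)) ^ (b' : ℕ))]
    exact key0 _ _ _ _ (by simpa using h)

theorem one_sub_X_pow_coeff (n k : ℕ) : ((1 - X : ℝ[X]) ^ n).coeff k = (-1) ^ k * (n.choose k : ℝ) := by
  have : (1 - X : ℝ[X]) ^ n = ((1 + X) ^ n).comp (C (-1) * X) := by
    simp [sub_eq_add_neg]
  rw [this, comp_C_mul_X_coeff, coeff_one_add_X_pow, mul_comm]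

theorem det_top (n : ℕ) (u : Fin n → ℕ) (r : Fin n → ℝ) (s : ℝ[X]) (hs : s.coeff 0 = 1) :
    (Matrix.of fun i a : Fin n => (C (r i) * (1 - X) ^ (2 * u i) * s).coeff (a : ℕ)).det =
    (∏ i, r i) * ((∏ a : Fin n, ((-1 : ℝ) ^ (a : ℕ) * 2 ^ (a : ℕ) / ((a : ℕ).factorial : ℝ))) *
      ∏ i : Fin n, ∏ j ∈ Ioi i, ((u j : ℝ) - u i)) := by
  have h1 : (Matrix.of fun i a : Fin n => (C (r i) * (1 - X) ^ (2 * u i) * s).coeff (a : ℕ)) =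
      Matrix.of fun i a => r i * (((Matrix.of fun i k : Fin n => ((1 - X : ℝ[X]) ^ (2 * u i)).coeff (k : ℕ)) *
        (Matrix.of fun k a : Fin n => if k ≤ a then s.coeff ((a : ℕ) - k) else 0)) i a) := by
    ext i a
    simp only [Matrix.of_apply]
    rw [mul_assoc, coeff_C_mul, Matrix.mul_apply, coeff_mul,
      Nat.sum_antidiagonal_eq_sum_range_succ (fun k l => ((1 - X : ℝ[X]) ^ (2 * u i)).coeff k * s.coeff l)]
    congr 1
    simp only [Matrix.of_apply, Fin.le_def]
    rw [Fin.sum_univ_eq_sum_range (fun k => ((1 - X : ℝ[X]) ^ (2 * u i)).coeff k *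
      if k ≤ (a : ℕ) then s.coeff ((a : ℕ) - k) else 0) n]
    have : range (a : ℕ).succ ⊆ range n := range_subset_range.2 a.2
    rw [← sum_subset this]
    · refine sum_congr rfl fun k hk => ?_
      rw [if_pos (by simpa [Nat.lt_succ_iff] using hk)]
    · intro k _ hk
      rw [if_neg (by simpa [Nat.lt_succ_iff] using hk), mul_zero]
  rw [h1, Matrix.det_mul_column, Matrix.det_mul]
  congr 1
  rw [Matrix.det_of_isUpperTriangular (M := Matrix.of fun k a : Fin n => if k ≤ a then s.coeff ((a : ℕ) - k) else 0)]
  swap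
  · intro i j hij
    simp only [id] at hij
    simp [not_le.2 hij]
  simp only [Matrix.of_apply, le_refl, if_true, Nat.sub_self, hs, prod_const_one, mul_one]
  have h2 := Matrix.det_eval_matrixOfPolynomials_eq_det_vandermonde (fun i : Fin n => ((2 * u i : ℕ) : ℝ))
    (fun i => descPochhammer ℝ i) (fun i => descPochhammer_natDegree ℝ i) (fun i => monic_descPochhammer ℝ i)
  have h3 : (Matrix.of fun i k : Fin n => ((1 - X : ℝ[X]) ^ (2 * u i)).coeff (k : ℕ)) =
      Matrix.of fun i k : Fin n => ((-1 : ℝ) ^ (k : ℕ) / ((k : ℕ).factorial : ℝ)) *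
        (Matrix.of (fun i j : Fin n => (descPochhammer ℝ j).eval ((2 * u i : ℕ) : ℝ))) i k := by
    ext i k
    simp only [Matrix.of_apply]
    rw [one_sub_X_pow_coeff, descPochhammer_eval_eq_descFactorial, Nat.descFactorial_eq_factorial_mul_choose]
    have : ((k : ℕ).factorial : ℝ) ≠ 0 := by positivity
    push_cast
    field_simp
  rw [h3, Matrix.det_mul_row, ← h2, Matrix.det_vandermonde]
  have h4 : ∏ i : Fin n, ∏ j ∈ Ioi i, (((2 * u j : ℕ) : ℝ) - ((2 * u i : ℕ) : ℝ)) =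
      (∏ a : Fin n, (2 : ℝ) ^ (a : ℕ)) * ∏ i : Fin n, ∏ j ∈ Ioi i, ((u j : ℝ) - u i) := by
    have : ∀ i j : Fin n, ((2 * u j : ℕ) : ℝ) - ((2 * u i : ℕ) : ℝ) = 2 * ((u j : ℝ) - u i) := by
      intro i j; push_cast; ring
    simp only [this, prod_mul_distrib, prod_const, Fin.card_Ioi]
    congr 1
    rw [← Equiv.prod_comp Fin.revPerm]
    refine prod_congr rfl fun i _ => ?_
    congr 1
    simp [Fin.val_rev]
    omega
  rw [h4, ← mul_assoc, ← prod_mul_distrib]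
  congr 1
  refine prod_congr rfl fun a _ => ?_
  ring

theorem prod_Ioi_eq (n : ℕ) (f : ℕ → ℕ → ℝ) :
    ∏ i : Fin n, ∏ j ∈ Ioi i, f i j = ∏ j ∈ range n, ∏ i ∈ range j, f i j := by
  have h1 : ∏ i : Fin n, ∏ j ∈ Ioi i, f i j = ∏ j : Fin n, ∏ i ∈ Iio j, f i j := by
    apply prod_comm'
    simp
  rw [h1, ← Fin.prod_univ_eq_prod_range (fun j => ∏ i ∈ range j, f i j)]
  refine prod_congr rfl fun j _ => ?_
  refine prod_bij (fun i _ => (i : ℕ)) ?_ ?_ ?_ ?_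
  · intro a ha; simpa using ha
  · intro a _ b _ h; exact Fin.ext h
  · intro b hb
    have := mem_range.1 hb
    exact ⟨⟨b, this.trans j.2⟩, by simpa [Fin.lt_def] using this, rfl⟩
  · intro a _; rfl

end PartB



section PartC

open Finset

/-- the weight without sign -/
noncomputable def Gp (β : ℝ) (M : ℕ) (α : ℝ) (j : ℕ) : ℝ[X] :=
  pochPoly (X + C (α - M)) (M - j) * pochPoly (X + C (β - j)) j

theorem pochPoly_succ (a : ℝ[X]) (k : ℕ) : pochPoly a (k + 1) = pochPoly a k * (a + (k : ℝ[X])) := by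
  simp [pochPoly, prod_range_succ]

theorem pochPoly_succ' (a : ℝ[X]) (k : ℕ) : pochPoly a (k + 1) = a * pochPoly (a + 1) k := by
  rw [pochPoly, prod_range_succ', mul_comm, pochPoly]
  congr 1
  · simp
  · refine prod_congr rfl fun i _ => ?_
    push_cast; ring

theorem Gp_succ (β : ℝ) (M : ℕ) (α : ℝ) (j : ℕ) (h : j ≤ M) :
    Gp β (M + 1) α (j + 1) = Gp β (M + 1) α j + C (β - α) * Gp β M (α - 1) j := by
  obtain ⟨t, rfl⟩ := Nat.exists_eq_add_of_le h
  simp only [Gp]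
  rw [show j + t + 1 - (j + 1) = t by omega, show j + t + 1 - j = t + 1 by omega,
    show j + t - j = t by omega, pochPoly_succ (k := t), pochPoly_succ' (k := j)]
  have e1 : (X + C (β - ((j + 1 : ℕ) : ℝ)) + 1 : ℝ[X]) = X + C (β - j) := by
    simp; ring
  have e2 : (α - 1 - ((j + t : ℕ) : ℝ)) = α - ((j + t + 1 : ℕ) : ℝ) := by push_cast; ring
  rw [e1, e2]
  simp
  ring

/-- rising factorial -/
noncomputable def rf (a : ℝ) (n : ℕ) : ℝ := ∏ i ∈ range n, (a + i)

theorem rf_succ (a : ℝ) (n : ℕ) : rf a (n + 1) = a * rf (a + 1) n := by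
  rw [rf, prod_range_succ', mul_comm, rf]
  congr 1
  · simp
  · refine prod_congr rfl fun i _ => ?_
    push_cast; ring

theorem Gp_interp (β : ℝ) (j : ℕ) : ∀ (M : ℕ) (α : ℝ), j ≤ M →
    Gp β M α j = ∑ n ∈ range (M + 1), C ((j.choose n : ℝ) * rf (β - α) n) * Gp β (M - n) (α - n) 0 := by
  induction j with
  | zero =>
    intro M α _
    rw [sum_range_succ']
    simp [rf]
  | succ j ih =>
    intro M α h
    obtain ⟨M, rfl⟩ : ∃ M', M = M' + 1 := ⟨M - 1, by omega⟩
    rw [Gp_succ _ _ _ _ (by omega), ih (M + 1) α (by omega), ih M (α - 1) (by omega),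
      sum_range_succ', sum_range_succ' (n := M + 1), mul_sum, add_right_comm, ← sum_add_distrib]
    congr 1
    · refine sum_congr rfl fun n _ => ?_
      rw [Nat.choose_succ_succ, rf_succ, show M + 1 - (n + 1) = M - n by omega,
        show β - (α - 1) = β - α + 1 by ring, show α - ((n + 1 : ℕ) : ℝ) = α - 1 - n by push_cast; ring]
      push_cast
      simp only [map_add, map_mul, map_sub]
      ring
    · simp

theorem TD.lin (c : ℝ) : TD (C (X + C c)) 1 1 := by
  rw [C_add]
  simpa using TD.varX.add (TD.const c).succ

theorem TD.poch (c : ℝ) (k : ℕ) : TD (C (pochPoly (X + C c) k)) k 1 := by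
  induction k with
  | zero => simpa [pochPoly] using TD.one
  | succ k ih =>
    rw [pochPoly_succ, C_mul, add_assoc]
    have := ih.mul (TD.lin (c + k))
    simpa using this

theorem TD.fall (n : ℕ) : TD (∏ i ∈ range n, (X - C (C (i : ℝ)))) n (X ^ n) := by
  induction n with
  | zero => simpa using TD.one
  | succ n ih =>
    rw [prod_range_succ, pow_succ]
    refine ih.mul ?_
    have := TD.varZ.add (TD.const (-(n : ℝ))).succ
    simpa [sub_eq_add_neg] using this

/-- bivariate interpolation of the weight -/
noncomputable def FG (β : ℝ) (M : ℕ) (α : ℝ) : ℝ[X][X] :=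
  ∑ n ∈ range (M + 1), C (C (rf (β - α) n / n.factorial)) *
    ((∏ i ∈ range n, (X - C (C (i : ℝ)))) * C (Gp β (M - n) (α - n) 0))

noncomputable def SG (β : ℝ) (M : ℕ) (α : ℝ) : ℝ[X] :=
  ∑ n ∈ range (M + 1), C (rf (β - α) n / n.factorial) * X ^ n

theorem SG_zero (β M α) : (SG β M α).coeff 0 = 1 := by
  rw [SG, finsetSum_coeff, sum_eq_single 0]
  · simp [rf]
  · intro b _ hb
    simp [coeff_X_pow, Ne.symm hb]
  · simp

theorem TD_FG (β M α) : TD (FG β M α) M (SG β M α) := by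
  refine TD.sum _ fun n hn => ?_
  have hn' : n ≤ M := by simpa [Nat.lt_succ_iff] using hn
  have := (TD.const (rf (β - α) n / n.factorial)).mul ((TD.fall n).mul (TD.poch (α - n - ((M - n : ℕ) : ℝ)) (M - n)))
  rw [show 0 + (n + (M - n)) = M by omega, mul_one] at this
  simpa [Gp, pochPoly] using this

theorem eval_FG (β M α) (j : ℕ) (hj : j ≤ M) : (FG β M α).eval (j : ℝ[X]) = Gp β M α j := by
  rw [Gp_interp β j M α hj, FG, eval_finsetSum]
  refine sum_congr rfl fun n _ => ?_
  have h1 : ∏ i ∈ range n, ((j : ℝ[X]) - C (i : ℝ)) = C ((n.factorial : ℝ) * (j.choose n : ℝ)) := by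
    have := descPochhammer_eval_eq_descFactorial ℝ j n
    rw [descPochhammer_eval_eq_prod_range, Nat.descFactorial_eq_factorial_mul_choose] at this
    push_cast at this
    rw [← this]
    simp
  simp only [eval_mul, eval_C, eval_prod, eval_sub, eval_X]
  rw [h1, ← mul_assoc, ← C_mul]
  congr 2
  have : (n.factorial : ℝ) ≠ 0 := by positivity
  field_simp

/-- bivariate version of `Y(θ_{x-z-1})` -/
noncomputable def FY (α β : ℝ) (Y : ℝ[X]) : ℝ[X][X] :=
  ∑ k ∈ range (Y.natDegree + 1), C (C (Y.coeff k)) *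
    ((C (X + C (-1)) - X) * ((C (X + C (-1)) - X) + C (C (α + β + 1)))) ^ k

theorem TD_FY (α β Y) : TD (FY α β Y) (2 * Y.natDegree) (C Y.leadingCoeff * (1 - X) ^ (2 * Y.natDegree)) := by
  have h1 : TD (C (X + C (-1)) - X) 1 (1 - X) := by
    have := (TD.lin (-1)).add ((TD.const (-1)).mul TD.varZ)
    have e1 : (C (X + C (-1)) - X : ℝ[X][X]) = C (X + C (-1)) + C (C (-1)) * X := by
      rw [C_neg, C_neg, C_1, C_1]; ring
    have e2 : (1 - X : ℝ[X]) = 1 + C (-1) * X := by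
      rw [C_neg, C_1]; ring
    rw [e1, e2]
    exact this
  have h2 := h1.mul (h1.add (TD.const (α + β + 1)).succ)
  rw [add_zero, ← pow_two] at h2
  rw [FY, sum_range_succ, ← zero_add (C Y.leadingCoeff * (1 - X) ^ (2 * Y.natDegree))]
  refine TD.add ?_ ?_
  · have := TD.sum (range Y.natDegree) (d := 2 * Y.natDegree) (S := fun _ => 0) (fun k hk =>
      ((TD.const (Y.coeff k)).mul (h2.pow k)).of_lt (e := 2 * Y.natDegree)
        (by have := mem_range.1 hk; omega))
    simpa using this
  · have := (TD.const (Y.coeff Y.natDegree)).mul (h2.pow Y.natDegree)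
    rw [← pow_mul, zero_add, mul_comm Y.natDegree] at this
    exact this

theorem eval_FY (α β Y) (j : ℕ) : (FY α β Y).eval (j : ℝ[X]) =
    Y.comp ((θpoly α β).comp (X - C (((j + 1 : ℕ) : ℝ)))) := by
  rw [comp, eval₂_eq_sum_range, FY, eval_finsetSum]
  refine sum_congr rfl fun n _ => ?_
  simp only [eval_mul, eval_C, eval_pow, eval_sub, eval_X, eval_add, θpoly, mul_comp, X_comp, add_comp, C_comp]
  have : (X + C (-1) - (j : ℝ[X])) = X - C ((j + 1 : ℕ) : ℝ) := by simp; ring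
  rw [this]

theorem abstract_det (m1 m2 : ℕ) (F1 : Fin m1 → ℝ[X][X]) (F2 : Fin m2 → ℝ[X][X])
    (d1 : Fin m1 → ℕ) (d2 : Fin m2 → ℕ) (S1 : Fin m1 → ℝ[X]) (S2 : Fin m2 → ℝ[X])
    (h1 : ∀ i, TD (F1 i) (d1 i) (S1 i)) (h2 : ∀ i, TD (F2 i) (d2 i) (S2 i))
    (A : Matrix (Fin m1 ⊕ Fin m2) (Fin m1 ⊕ Fin m2) ℝ[X])
    (hA1 : ∀ i j, A (Sum.inl i) j = C ((-1 : ℝ) ^ (finSumFinEquiv j : ℕ)) *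
      (F1 i).eval (((finSumFinEquiv j : ℕ) : ℝ[X])))
    (hA2 : ∀ i j, A (Sum.inr i) j = (F2 i).eval (((finSumFinEquiv j : ℕ) : ℝ[X]))) :
    (X ^ (∑ a : Fin m1, (m2 + (a : ℕ)) + ∑ b : Fin m2, (m1 + (b : ℕ))) * A.det).natDegree ≤
      ∑ i, (d1 i + m2) + ∑ i, (d2 i + m1) ∧
    (X ^ (∑ a : Fin m1, (m2 + (a : ℕ)) + ∑ b : Fin m2, (m1 + (b : ℕ))) * A.det).coeff
      (∑ i, (d1 i + m2) + ∑ i, (d2 i + m1)) =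
      (Matrix.of fun i a : Fin m1 => (S1 i).coeff a).det *
      (Matrix.of fun i a : Fin m2 => (S2 i).coeff a).det * (Wmat m1 m2).det := by
  have hW : (Wmat m1 m2).det ≠ 0 := by
    rw [det_Wmat]
    refine mul_ne_zero (prod_ne_zero_iff.2 fun a _ => ?_) (prod_ne_zero_iff.2 fun a _ => ?_)
    · exact mul_ne_zero (by positivity) (by simp)
    · positivity
  set V := (Wmat m1 m2)⁻¹ with hV
  have hWV : Wmat m1 m2 * V = 1 := Matrix.mul_nonsing_inv _ (Ne.isUnit hW)
  let om : Fin m1 ⊕ Fin m2 → ℕ := Sum.elim (fun a => m2 + (a : ℕ)) (fun b => m1 + (b : ℕ))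
  let rho : Fin m1 ⊕ Fin m2 → ℕ := Sum.elim (fun i => d1 i + m2) (fun i => d2 i + m1)
  let N := A * V.map C
  let B : Matrix (Fin m1 ⊕ Fin m2) (Fin m1 ⊕ Fin m2) ℝ[X] := Matrix.of fun i k => X ^ om k * N i k
  have hBdet : B.det = C V.det * (X ^ (∑ k, om k) * A.det) := by
    simp only [B]
    rw [Matrix.det_mul_row, Matrix.det_mul, prod_pow_eq_pow_sum]
    have : (V.map C).det = C V.det := (RingHom.map_det (C : ℝ →+* ℝ[X]) V).symm
    rw [this]; ring
  -- functionals
  let lam1 : (Fin m1 ⊕ Fin m2) → ℕ → ℝ := fun k n => ∑ j, (-1 : ℝ) ^ (finSumFinEquiv j : ℕ) *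
    ((finSumFinEquiv j : ℕ) : ℝ) ^ n * V j k
  let lam2 : (Fin m1 ⊕ Fin m2) → ℕ → ℝ := fun k n => ∑ j,
    ((finSumFinEquiv j : ℕ) : ℝ) ^ n * V j k
  have hl1 : ∀ k (n : Fin m1), lam1 k n = (1 : Matrix (Fin m1 ⊕ Fin m2) (Fin m1 ⊕ Fin m2) ℝ) (Sum.inl n) k := by
    intro k n
    rw [← hWV, Matrix.mul_apply]; rfl
  have hl2 : ∀ k (n : Fin m2), lam2 k n = (1 : Matrix (Fin m1 ⊕ Fin m2) (Fin m1 ⊕ Fin m2) ℝ) (Sum.inr n) k := by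
    intro k n
    rw [← hWV, Matrix.mul_apply]; rfl
  have hN1 : ∀ i k, N (Sum.inl i) k = ∑ n ∈ range ((F1 i).natDegree + 1), (F1 i).coeff n * C (lam1 k n) := by
    intro i k
    simp only [N, lam1, Matrix.mul_apply, hA1, Matrix.map_apply, eval_eq_sum_range, map_sum, mul_sum, sum_mul]
    rw [sum_comm]
    refine sum_congr rfl fun n _ => sum_congr rfl fun j _ => ?_
    simp only [map_mul, map_pow, map_natCast]
    ring
  have hN2 : ∀ i k, N (Sum.inr i) k = ∑ n ∈ range ((F2 i).natDegree + 1), (F2 i).coeff n * C (lam2 k n) := by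
    intro i k
    simp only [N, lam2, Matrix.mul_apply, hA2, Matrix.map_apply, eval_eq_sum_range, map_sum, mul_sum, sum_mul]
    rw [sum_comm]
    refine sum_congr rfl fun n _ => sum_congr rfl fun j _ => ?_
    simp only [map_mul, map_pow, map_natCast]
    ring
  have hlz1 : ∀ k n, lam1 k n ≠ 0 → om k ≤ n + m2 := by
    intro k n hn
    by_cases hnm : n < m1
    · have := hl1 k ⟨n, hnm⟩
      simp only at this
      rw [this] at hn
      have hk : Sum.inl ⟨n, hnm⟩ = k := by
        by_contra hc
        exact hn (Matrix.one_apply_ne hc)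
      rw [← hk]
      simp [om, add_comm]
    · rcases k with a | b
      · simp only [om, Sum.elim_inl]; omega
      · simp only [om, Sum.elim_inr]; omega
  have hlz2 : ∀ k n, lam2 k n ≠ 0 → om k ≤ n + m1 := by
    intro k n hn
    by_cases hnm : n < m2
    · have := hl2 k ⟨n, hnm⟩
      simp only at this
      rw [this] at hn
      have hk : Sum.inr ⟨n, hnm⟩ = k := by
        by_contra hc
        exact hn (Matrix.one_apply_ne hc)
      rw [← hk]
      simp [om, add_comm]
    · rcases k with a | b
      · simp only [om, Sum.elim_inl]; omega
      · simp only [om, Sum.elim_inr]; omega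
  have T1 := fun i k => (h1 i).functional (lam1 k) (om k) m2 _ (Nat.lt_succ_self _) (hlz1 k)
  have T2 := fun i k => (h2 i).functional (lam2 k) (om k) m1 _ (Nat.lt_succ_self _) (hlz2 k)
  have hdeg : ∀ i k, (B i k).natDegree ≤ rho i := by
    rintro (i | i) k
    · simp only [B, Matrix.of_apply, hN1]; exact (T1 i k).1
    · simp only [B, Matrix.of_apply, hN2]; exact (T2 i k).1
  have hmain := det_coeff_of_le B rho hdeg
  have htop : (Matrix.of fun i j => (B i j).coeff (rho i)) =
      Matrix.fromBlocks (Matrix.of fun i a : Fin m1 => (S1 i).coeff a) 0 0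
        (Matrix.of fun i a : Fin m2 => (S2 i).coeff a) := by
    ext i k
    rcases i with i | i
    · have := (T1 i k).2
      rw [← hN1] at this
      change (B (Sum.inl i) k).coeff (d1 i + m2) = _ at this
      change (B (Sum.inl i) k).coeff (d1 i + m2) = _
      rw [this]
      rcases k with a | b
      · have ho : om (Sum.inl a) = m2 + a := rfl
        rw [ho, if_pos (by omega), show m2 + (a : ℕ) - m2 = a by omega, hl1]
        simp
      · have ho : om (Sum.inr b) = m1 + b := rfl
        rw [ho, Matrix.fromBlocks_apply₁₂, Matrix.zero_apply]
        split_ifs with hc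
        · have := hl1 (Sum.inr b) ⟨m1 + b - m2, by omega⟩
          simp only at this
          rw [this]; simp
        · rfl
    · have := (T2 i k).2
      rw [← hN2] at this
      change (B (Sum.inr i) k).coeff (d2 i + m1) = _ at this
      change (B (Sum.inr i) k).coeff (d2 i + m1) = _
      rw [this]
      rcases k with a | b
      · have ho : om (Sum.inl a) = m2 + a := rfl
        rw [ho, Matrix.fromBlocks_apply₂₁, Matrix.zero_apply]
        split_ifs with hc
        · have := hl2 (Sum.inl a) ⟨m2 + a - m1, by omega⟩
          simp only at this
          rw [this]; simp
        · rfl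
      · have ho : om (Sum.inr b) = m1 + b := rfl
        rw [ho, if_pos (by omega), show m1 + (b : ℕ) - m1 = b by omega, hl2]
        simp
  have hVW : V.det * (Wmat m1 m2).det = 1 := by
    rw [mul_comm, ← Matrix.det_mul, hWV, Matrix.det_one]
  have hV0 : V.det ≠ 0 := left_ne_zero_of_mul_eq_one hVW
  rw [htop, Matrix.det_fromBlocks_zero₁₂, hBdet, natDegree_C_mul hV0, coeff_C_mul] at hmain
  simp only [Fintype.sum_sum_type, om, rho, Sum.elim_inl, Sum.elim_inr] at hmain
  refine ⟨hmain.1, ?_⟩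
  rw [← hmain.2]
  linear_combination (-1 : ℝ) * hVW * (X ^ (∑ a : Fin m1, (m2 + (a : ℕ)) + ∑ b : Fin m2, (m1 + (b : ℕ))) * A.det).coeff
      (∑ i, (d1 i + m2) + ∑ i, (d2 i + m1))

end PartC



section PartE

open Finset

theorem monic_poch (c : ℝ) (k : ℕ) : (pochPoly (X + C c) k).Monic ∧ (pochPoly (X + C c) k).natDegree = k := by
  have h : ∀ i : ℕ, (X + C c + (i : ℝ[X])) = X + C (c + i) := by
    intro i; simp [add_assoc]
  have hm : ∀ i ∈ range k, (X + C c + (i : ℝ[X])).Monic := by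
    intro i _; rw [h]; exact monic_X_add_C _
  refine ⟨monic_prod_of_monic _ _ hm, ?_⟩
  rw [pochPoly, natDegree_prod_of_monic _ _ hm]
  rw [sum_congr rfl fun i _ => by rw [h, natDegree_X_add_C]]
  simp

theorem sum_T (n : ℕ) : ∑ i ∈ range n, i = n.choose 2 := by
  rw [Finset.sum_range_id, Nat.choose_two_right]

theorem sum_T1 (n : ℕ) : ∑ i ∈ Icc 1 (n - 1), (n - i) = n.choose 2 := by
  rw [← sum_T, ← sum_range_reflect]
  cases n with
  | zero => simp
  | succ n =>
    rw [sum_range_succ]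
    rw [show Icc 1 (n + 1 - 1) = Ico 1 (n + 1) by ext; simp only [mem_Icc, mem_Ico]; omega, sum_Ico_eq_sum_range]
    simp
    refine sum_congr rfl fun i _ => ?_
    omega

theorem sum_T2 (n : ℕ) : ∑ i ∈ Icc 1 (n - 1), i = n.choose 2 := by
  rw [← sum_T]
  cases n with
  | zero => simp
  | succ n =>
    rw [sum_range_succ']
    rw [show Icc 1 (n + 1 - 1) = Ico 1 (n + 1) by ext; simp only [mem_Icc, mem_Ico]; omega, sum_Ico_eq_sum_range]
    simp
    refine sum_congr rfl fun i _ => ?_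
    omega

theorem T_add (a b : ℕ) : (a + b).choose 2 = a.choose 2 + b.choose 2 + a * b := by
  induction b with
  | zero => simp
  | succ b ih =>
    rw [← sum_T, ← sum_T b.succ, ← add_assoc, sum_range_succ, sum_range_succ, sum_T, sum_T, ih]
    ring

theorem T_two (a : ℕ) : a * (a - 1) = 2 * a.choose 2 := by
  rw [← sum_T, mul_comm 2, Finset.sum_range_id_mul_two]

theorem ppoly_lead (m1 m2 : ℕ) (α β : ℝ) :
    (ppoly m1 m2 α β).natDegree = 2 * m1.choose 2 ∧
    (ppoly m1 m2 α β).leadingCoeff = (-1) ^ (m1.choose 2) := by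
  have hs : ∀ n : ℕ, ((-1 : ℝ) ^ n) ≠ 0 := fun n => by simp
  constructor
  · rw [ppoly, natDegree_prod]
    · rw [← sum_T1, mul_sum]
      refine sum_congr rfl fun i _ => ?_
      rw [mul_assoc, natDegree_C_mul (hs _), (monic_poch _ _).1.natDegree_mul (monic_poch _ _).1,
        (monic_poch _ _).2, (monic_poch _ _).2, two_mul]
    · intro i _
      exact mul_ne_zero (mul_ne_zero (C_ne_zero.2 (hs _)) (monic_poch _ _).1.ne_zero) (monic_poch _ _).1.ne_zero
  · rw [ppoly, leadingCoeff_prod, ← sum_T1, ← prod_pow_eq_pow_sum]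
    refine prod_congr rfl fun i _ => ?_
    rw [leadingCoeff_mul, leadingCoeff_mul, leadingCoeff_C, (monic_poch _ _).1.leadingCoeff,
      (monic_poch _ _).1.leadingCoeff, mul_one, mul_one]

theorem qpoly_lead (m1 m2 : ℕ) (α β : ℝ) :
    (qpoly m1 m2 α β).natDegree = (m1 + m2).choose 2 ∧
    (qpoly m1 m2 α β).leadingCoeff = (-1) ^ ((m1 + m2).choose 2) * 2 ^ ((m1 + m2).choose 2) := by
  have hs : ∀ n : ℕ, ((-1 : ℝ) ^ n) ≠ 0 := fun n => by simp
  have hl : ∀ h i : ℕ, (2 * (X - C ((m1 + m2 : ℕ) : ℝ)) + C (α + β + (i : ℝ) + (h : ℝ))) =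
      C 2 * X + C (-2 * ((m1 + m2 : ℕ) : ℝ) + (α + β + (i : ℝ) + (h : ℝ))) := by
    intro h i
    simp only [map_add, map_mul, map_neg, map_natCast, map_ofNat]
    ring
  have h2 : (2 : ℝ) ≠ 0 := two_ne_zero
  have hne : ∀ c : ℝ, (C 2 * X + C c : ℝ[X]) ≠ 0 := by
    intro c h
    have := natDegree_linear (b := c) h2
    rw [h] at this
    simp at this
  simp only [qpoly, hl, Nat.choose_two_right]
  rw [← Nat.choose_two_right]
  constructor
  · rw [natDegree_C_mul (hs _), natDegree_prod _ _ fun h _ => prod_ne_zero_iff.2 fun i _ => hne _, ← sum_T2]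
    refine sum_congr rfl fun h _ => ?_
    rw [natDegree_prod _ _ fun i _ => hne _, sum_congr rfl fun i _ => natDegree_linear h2]
    simp
  · rw [leadingCoeff_mul, leadingCoeff_C, leadingCoeff_prod]
    congr 1
    rw [← sum_T2, ← prod_pow_eq_pow_sum]
    refine prod_congr rfl fun h _ => ?_
    rw [leadingCoeff_prod, prod_congr rfl fun i _ => leadingCoeff_linear h2]
    simp

theorem D_eq (m1 m2 : ℕ) (α β : ℝ) (Y : ℕ → ℝ[X]) :
    Dpoly m1 m2 α β Y = (Matrix.of fun i j : Fin m1 ⊕ Fin m2 =>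
      entry m1 m2 α β Y ((finSumFinEquiv i : ℕ) + 1) ((finSumFinEquiv j : ℕ) + 1)).det := by
  rw [Dpoly, ← Matrix.det_submatrix_equiv_self finSumFinEquiv]
  rfl

theorem row_one (m1 m2 : ℕ) (α β : ℝ) (Y : ℕ → ℝ[X]) (i j : ℕ) (hi : i + 1 ≤ m1) (hj : j < m1 + m2) :
    entry m1 m2 α β Y (i + 1) (j + 1) = C ((-1) ^ j) * (C ((-1) ^ (m1 + m2 - 1)) *
      (eval (j : ℝ[X]) (FG β (m1 + m2 - 1) α) * eval (j : ℝ[X]) (FY α β (Y (i + 1))))) := by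
  rw [eval_FG _ _ _ _ (by omega), eval_FY, entry, if_pos hi, Gp]
  obtain ⟨t, ht⟩ : ∃ t, m1 + m2 = j + 1 + t := Nat.exists_eq_add_of_le hj
  rw [ht, show j + 1 + t - (j + 1) = t by omega, show j + 1 + t - 1 = j + t by omega,
    show j + t - j = t by omega, show j + 1 - 1 = j by omega,
    show α - ((j + 1 + t : ℕ) : ℝ) + 1 = α - ((j + t : ℕ) : ℝ) by push_cast; ring,
    show β + 1 - ((j + 1 : ℕ) : ℝ) = β - j by push_cast; ring]
  have : C ((-1 : ℝ) ^ t) = C ((-1) ^ j) * C ((-1) ^ (j + t)) := by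
    rw [← C_mul, pow_add, ← mul_assoc, ← mul_pow]; simp
  rw [this]
  ring

theorem D_lead (m1 m2 : ℕ) (hm : 1 ≤ m1 + m2) (α β : ℝ) (Y : ℕ → ℝ[X])
    (V1 V2 R : ℝ)
    (hV1 : V1 = ∏ i : Fin m1, ∏ j ∈ Ioi i, (((Y (j + 1)).natDegree : ℝ) - (Y (i + 1)).natDegree))
    (hV2 : V2 = ∏ i : Fin m2, ∏ j ∈ Ioi i, (((Y (m1 + j + 1)).natDegree : ℝ) - (Y (m1 + i + 1)).natDegree))
    (hR : R = (∏ i : Fin m1, (Y (i + 1)).leadingCoeff) * ∏ i : Fin m2, (Y (m1 + i + 1)).leadingCoeff)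
    (h0 : V1 * V2 * R ≠ 0) :
    (Dpoly m1 m2 α β Y).natDegree + m1.choose 2 + m2.choose 2 + 2 * (m1 * m2) = 
      2 * (∑ i : Fin m1, (Y (i + 1)).natDegree + ∑ i : Fin m2, (Y (m1 + i + 1)).natDegree)
       + m1 * (m1 + m2 - 1) + m1 * m2 + m2 * m1 ∧
    (Dpoly m1 m2 α β Y).leadingCoeff =
      (-1) ^ (m1 * (m1 + m2 - 1) + m2.choose 2) * 2 ^ ((m1 + m2).choose 2) * (V1 * V2 * R) := by
  have key := abstract_det m1 m2
    (fun i => C (C ((-1) ^ (m1 + m2 - 1))) * (FG β (m1 + m2 - 1) α * FY α β (Y (i + 1))))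
    (fun i => FY α β (Y (m1 + i + 1)))
    (fun i => 0 + ((m1 + m2 - 1) + 2 * (Y (i + 1)).natDegree))
    (fun i => 2 * (Y (m1 + i + 1)).natDegree) _ _
    (fun i => (TD.const _).mul ((TD_FG _ _ _).mul (TD_FY _ _ _)))
    (fun i => TD_FY _ _ _)
    (Matrix.of fun i j : Fin m1 ⊕ Fin m2 =>
      entry m1 m2 α β Y ((finSumFinEquiv i : ℕ) + 1) ((finSumFinEquiv j : ℕ) + 1))
    (by
      intro i j
      simp only [Matrix.of_apply, finSumFinEquiv_apply_left, Fin.val_castAdd, eval_mul, eval_C]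
      exact row_one m1 m2 α β Y i _ (by omega) (finSumFinEquiv j).2)
    (by
      intro i j
      simp only [Matrix.of_apply, finSumFinEquiv_apply_right, Fin.val_natAdd]
      rw [eval_FY, entry, if_neg (by omega), one_mul])
  rw [← D_eq] at key
  have e1 : (Matrix.of fun i a : Fin m1 => (C ((-1) ^ (m1 + m2 - 1)) * (SG β (m1 + m2 - 1) α *
      (C (Y (i + 1)).leadingCoeff * (1 - X) ^ (2 * (Y (i + 1)).natDegree)))).coeff a) =
      Matrix.of fun i a : Fin m1 => (C ((-1) ^ (m1 + m2 - 1) * (Y (i + 1)).leadingCoeff) * 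
       (1 - X) ^ (2 * (Y (i + 1)).natDegree) * SG β (m1 + m2 - 1) α).coeff a := by
    ext i a
    simp only [Matrix.of_apply, C_mul]
    congr 1
    ring
  have e2 : (Matrix.of fun i a : Fin m2 => 
      (C (Y (m1 + i + 1)).leadingCoeff * (1 - X) ^ (2 * (Y (m1 + i + 1)).natDegree)).coeff a) =
      Matrix.of fun i a : Fin m2 => (C (Y (m1 + i + 1)).leadingCoeff * 
       (1 - X) ^ (2 * (Y (m1 + i + 1)).natDegree) * 1).coeff a := by
    simp
  rw [e1, e2, det_top m1 (fun i => (Y (i + 1)).natDegree) _ _ (SG_zero _ _ _),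
    det_top m2 (fun i => (Y (m1 + i + 1)).natDegree) _ _ (by simp), ← hV1, ← hV2, det_Wmat,
    prod_mul_distrib] at key
  obtain ⟨k1, k2⟩ := key
  have val : ∀ x1 x2 : ℝ, (∏ i : Fin m1, (-1 : ℝ) ^ (m1 + m2 - 1)) * x1 * ((∏ a : Fin m1, ((-1 : ℝ) ^ (a : ℕ) * 2 ^ (a : ℕ) / (a : ℕ).factorial)) * V1) *
      (x2 * ((∏ a : Fin m2, ((-1 : ℝ) ^ (a : ℕ) * 2 ^ (a : ℕ) / (a : ℕ).factorial)) * V2)) *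
      ((∏ a : Fin m1, ((a : ℕ).factorial * (-1 : ℝ) ^ (a : ℕ))) * ∏ b : Fin m2, ((b : ℕ).factorial * (2 : ℝ) ^ m1)) = 
      (-1) ^ (m1 * (m1 + m2 - 1) + m2.choose 2) * 2 ^ ((m1 + m2).choose 2) * (V1 * V2 * (x1 * x2)) := by
    intro x1 x2
    have f1 : (∏ a : Fin m1, ((-1 : ℝ) ^ (a : ℕ) * 2 ^ (a : ℕ) / (a : ℕ).factorial)) *
        (∏ a : Fin m1, ((a : ℕ).factorial * (-1 : ℝ) ^ (a : ℕ))) = 2 ^ (m1.choose 2) := by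
      rw [← prod_mul_distrib, ← sum_T, ← prod_pow_eq_pow_sum, ← Fin.prod_univ_eq_prod_range (fun i => (2 : ℝ) ^ i)]
      refine prod_congr rfl fun a _ => ?_
      have : ((a : ℕ).factorial : ℝ) ≠ 0 := by positivity
      field_simp
      rw [← pow_mul, mul_comm, pow_mul]; simp
    have f2 : (∏ a : Fin m2, ((-1 : ℝ) ^ (a : ℕ) * 2 ^ (a : ℕ) / (a : ℕ).factorial)) *
        (∏ b : Fin m2, ((b : ℕ).factorial * (2 : ℝ) ^ m1)) = (-1) ^ (m2.choose 2) * (2 ^ (m2.choose 2) * 2 ^ (m1 * m2)) := by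
      rw [← prod_mul_distrib, ← sum_T, ← prod_pow_eq_pow_sum, ← prod_pow_eq_pow_sum, ← Fin.prod_univ_eq_prod_range (fun i => (2 : ℝ) ^ i),
        ← Fin.prod_univ_eq_prod_range (fun i => (-1 : ℝ) ^ i)]
      have : (2 : ℝ) ^ (m1 * m2) = ∏ b : Fin m2, 2 ^ m1 := by simp [pow_mul]
      rw [this, ← prod_mul_distrib, ← prod_mul_distrib]
      refine prod_congr rfl fun a _ => ?_
      have : ((a : ℕ).factorial : ℝ) ≠ 0 := by positivity
      field_simp
    have f3 : (∏ i : Fin m1, (-1 : ℝ) ^ (m1 + m2 - 1)) = (-1) ^ (m1 * (m1 + m2 - 1)) := by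
      simp [← pow_mul, mul_comm]
    rw [f3, T_add, pow_add, pow_add, pow_add]
    linear_combination (-1) ^ (m1 * (m1 + m2 - 1)) * x1 * V1 * x2 * V2 * (f1 * (∏ a : Fin m2, ((-1 : ℝ) ^ (a : ℕ) * 2 ^ (a : ℕ) / (a : ℕ).factorial)) * (∏ b : Fin m2, ((b : ℕ).factorial * (2 : ℝ) ^ m1)) + f2 * 2 ^ (m1.choose 2))
  rw [val, ← hR] at k2
  set L := (-1 : ℝ) ^ (m1 * (m1 + m2 - 1) + m2.choose 2) * 2 ^ ((m1 + m2).choose 2) * (V1 * V2 * R) with hL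
  have hL0 : L ≠ 0 := mul_ne_zero (by positivity) h0
  set om := (∑ a : Fin m1, (m2 + (a : ℕ)) + ∑ b : Fin m2, (m1 + (b : ℕ))) with hom
  set dd := ∑ i : Fin m1, (0 + (m1 + m2 - 1 + 2 * (Y (↑i + 1)).natDegree) + m2) + ∑ i : Fin m2, (2 * (Y (m1 + ↑i + 1)).natDegree + m1) with hdd
  have hd : (X ^ om * Dpoly m1 m2 α β Y).natDegree = dd := by
    refine le_antisymm k1 (le_natDegree_of_ne_zero ?_)
    rw [k2]; exact hL0
  have hD0 : Dpoly m1 m2 α β Y ≠ 0 := by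
    intro h
    rw [h] at k2
    simp at k2
    exact hL0 k2.symm
  have hlc : (X ^ om * Dpoly m1 m2 α β Y).leadingCoeff = L := by
    rw [leadingCoeff, hd, k2]
  constructor
  · rw [natDegree_mul (pow_ne_zero _ X_ne_zero) hD0, natDegree_X_pow] at hd
    have o1 : om = m1 * m2 + m1.choose 2 + (m2 * m1 + m2.choose 2) := by
      rw [hom, sum_add_distrib, sum_add_distrib, Fin.sum_univ_eq_sum_range (fun i => i), Fin.sum_univ_eq_sum_range (fun i => i), sum_T, sum_T]
      simp
    have o2 : dd = m1 * (m1 + m2 - 1) + 2 * ∑ i : Fin m1, (Y (i + 1)).natDegree + m1 * m2 + (2 * ∑ i : Fin m2, (Y (m1 + i + 1)).natDegree + m2 * m1) := by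
      rw [hdd]
      simp only [sum_add_distrib, mul_sum]
      simp
    have := mul_comm m1 m2
    omega
  · rw [leadingCoeff_mul] at hlc
    simpa using hlc

end PartE


section PartD1

open Finset

theorem dvd_prod_sub {S ι : Type*} [CommRing S] (lam : S) (s : Finset ι) (f g : ι → S)
    (h : ∀ i ∈ s, lam ∣ f i - g i) : lam ∣ ∏ i ∈ s, f i - ∏ i ∈ s, g i := by
  rw [← Ideal.mem_span_singleton, ← Ideal.Quotient.eq, map_prod, map_prod]
  refine prod_congr rfl fun i hi => ?_
  rw [Ideal.Quotient.eq, Ideal.mem_span_singleton]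
  exact h i hi

theorem det_pow_dvd {S n : Type*} [CommRing S] [Fintype n] [DecidableEq n] (M : Matrix n n S)
    (I J : Finset n) (lam : S) (N : ℕ) (h : ∀ i ∈ I, ∀ j ∈ J, lam ∣ M i j) (hN : N + #Jᶜ ≤ #I) :
    lam ^ N ∣ M.det := by
  rw [Matrix.det_apply']
  refine dvd_sum fun σ _ => Dvd.dvd.mul_left ?_ _
  have hK : N ≤ #(J.filter fun i => σ i ∈ I) := by
    have h1 : I.map σ⁻¹.toEmbedding ⊆ (J.filter fun i => σ i ∈ I) ∪ Jᶜ := by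
      intro i hi
      obtain ⟨l, hl, rfl⟩ := mem_map.1 hi
      simp only [mem_union, mem_filter, mem_compl]
      by_cases hJ : σ⁻¹.toEmbedding l ∈ J
      · left; exact ⟨hJ, by simpa using hl⟩
      · right; exact hJ
    have h2 := (card_le_card h1).trans (card_union_le _ _)
    rw [card_map] at h2
    omega
  calc lam ^ N ∣ lam ^ #(J.filter fun i => σ i ∈ I) := pow_dvd_pow _ hK
    _ = ∏ i ∈ J.filter (fun i => σ i ∈ I), lam := by rw [prod_const]
    _ ∣ ∏ i ∈ J.filter (fun i => σ i ∈ I), M (σ i) i := prod_dvd_prod_of_dvd _ _ fun i hi => by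
        have := mem_filter.1 hi
        exact h _ this.2 _ this.1
    _ ∣ _ := prod_dvd_prod_of_subset _ _ _ (subset_univ _)

variable {S : Type*} [CommRing S]

def gw (x a b : S) (m j : ℕ) : S :=
  (-1) ^ (m - (j + 1)) * (∏ i ∈ range (m - (j + 1)), (x + (a - m + 1) + i)) *
    ∏ i ∈ range j, (x + (b + 1 - ((j + 1 : ℕ) : S)) + i)

def gt (x a b : S) (j : ℕ) : S := (x - ((j + 1 : ℕ) : S)) * ((x - ((j + 1 : ℕ) : S)) + (a + b + 1))

noncomputable def gM [Algebra ℝ S] (m1 m2 : ℕ) (x a b : S) (Y : ℕ → ℝ[X]) : Matrix (Fin (m1 + m2)) (Fin (m1 + m2)) S :=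
  Matrix.of fun i j => (if (i : ℕ) + 1 ≤ m1 then gw x a b (m1 + m2) j else 1) * aeval (gt x a b j) (Y (i + 1))

def gp (m1 m2 : ℕ) (x a b : S) : S :=
  ∏ i ∈ Icc 1 (m1 - 1), (-1) ^ (m1 - i) * (∏ k ∈ range (m1 - i), (x + (a - ((m1 + m2 : ℕ) : S) + 1) + k)) *
    ∏ k ∈ range (m1 - i), (x + (b - m1 + i) + k)

def gq (m1 m2 : ℕ) (x a b : S) : S :=
  (-1) ^ ((m1 + m2) * (m1 + m2 - 1) / 2) *
    ∏ h ∈ Icc 1 (m1 + m2 - 1), ∏ i ∈ Icc 1 h, (2 * (x - ((m1 + m2 : ℕ) : S)) + (a + b + i + h))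

/-- linear factors -/
def lamA (m : ℕ) (x a : S) (k : ℕ) : S := x + (a - m + 1) + k
def lamB (x b : S) (k : ℕ) : S := x + b - 1 - k
def lamQ (x a b : S) (e : ℕ) : S := 2 * x + a + b - 1 - e

theorem lamA_dvd (x a b : S) (m j k : ℕ) (h : k < m - (j + 1)) : lamA m x a k ∣ gw x a b m j :=
  Dvd.dvd.mul_right (Dvd.dvd.mul_left (dvd_prod_of_mem (fun i : ℕ => x + (a - m + 1) + (i : S)) (mem_range.2 h)) _) _

theorem lamB_dvd (x a b : S) (m j k : ℕ) (h : k < j) : lamB x b k ∣ gw x a b m j := by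
  refine Dvd.dvd.mul_left ?_ _
  have := dvd_prod_of_mem (fun i : ℕ => x + (b + 1 - ((j + 1 : ℕ) : S)) + (i : S)) (mem_range.2 (show j - 1 - k < j by omega))
  convert this using 1
  obtain ⟨t, rfl⟩ := Nat.exists_eq_add_of_lt h
  rw [show k + t + 1 - 1 - k = t by omega, lamB]
  push_cast; ring

theorem lamQ_dvd_gt (x a b : S) (j k : ℕ) : lamQ x a b (j + k) ∣ gt x a b k - gt x a b j := by
  refine ⟨(j : S) - k, ?_⟩
  simp only [gt, lamQ]; push_cast; ring

theorem lamQ_dvd_gw (x a b : S) (m j k : ℕ) (hjk : j < k) (hk : k < m) :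
    lamQ x a b (j + k) ∣ gw x a b m k - gw x a b m j := by
  obtain ⟨d, rfl⟩ := Nat.exists_eq_add_of_le hjk.le
  obtain ⟨t, rfl⟩ := Nat.exists_eq_add_of_lt hk
  have e1 : j + d + t + 1 - (j + d + 1) = t := by omega
  have e2 : j + d + t + 1 - (j + 1) = t + d := by omega
  have hw1 : gw x a b (j + d + t + 1) (j + d) = ((-1) ^ t * (∏ i ∈ range t, (x + (a - ((j + d + t + 1 : ℕ) : S) + 1) + i)) *
      ∏ i ∈ range j, (x + (b - j) + i)) * ∏ i ∈ range d, (x + (b - j - d) + i) := by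
    rw [gw, e1, add_comm j d, prod_range_add, mul_assoc, mul_assoc, mul_assoc]
    congr 2
    rw [mul_comm]
    congr 1 <;> refine prod_congr rfl fun i _ => ?_
    all_goals push_cast; ring
  have hw2 : gw x a b (j + d + t + 1) j = ((-1) ^ t * (∏ i ∈ range t, (x + (a - ((j + d + t + 1 : ℕ) : S) + 1) + i)) *
      ∏ i ∈ range j, (x + (b - j) + i)) * ((-1) ^ d * ∏ i ∈ range d, (x + (a - j - d) + i)) := by
    rw [gw, e2, prod_range_add, pow_add]
    have f1 : ∏ i ∈ range j, (x + (b + 1 - ((j + 1 : ℕ) : S)) + i) = ∏ i ∈ range j, (x + (b - j) + i) :=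
      prod_congr rfl fun i _ => by push_cast; ring
    have f2 : ∏ i ∈ range d, (x + (a - ((j + d + t + 1 : ℕ) : S) + 1) + ((t + i : ℕ) : S)) = ∏ i ∈ range d, (x + (a - j - d) + i) :=
      prod_congr rfl fun i _ => by push_cast; ring
    rw [f1, f2]; ring
  rw [hw1, hw2, ← mul_sub]
  refine Dvd.dvd.mul_left ?_ _
  have f3 : (-1) ^ d * ∏ i ∈ range d, (x + (a - j - d) + (i : S)) = ∏ i ∈ range d, (-1) * (x + (a - j - d) + ((d - 1 - i : ℕ) : S)) := by
    rw [prod_mul_distrib, prod_const, card_range, prod_range_reflect (fun i => x + (a - j - d) + (i : S))]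
  rw [f3]
  refine dvd_prod_sub _ _ _ _ fun i hi => ?_
  obtain ⟨r, rfl⟩ := Nat.exists_eq_add_of_lt (mem_range.1 hi)
  rw [show i + r + 1 - 1 - i = r by omega]
  refine ⟨1, ?_⟩
  simp only [lamQ]; push_cast; ring

theorem aeval_dvd {S : Type*} [CommRing S] [Algebra ℝ S] (lam u v : S) (p : ℝ[X]) (h : lam ∣ u - v) :
    lam ∣ aeval u p - aeval v p := by
  refine h.trans ?_
  have := sub_dvd_eval_sub u v (p.map (algebraMap ℝ S))
  simpa [eval_map_algebraMap] using this

theorem gM_lamA [Algebra ℝ S] (m1 m2 : ℕ) (x a b : S) (Y) (k : ℕ) (hk : k < m1) :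
    lamA (m1 + m2) x a k ^ (m1 - 1 - k) ∣ (gM m1 m2 x a b Y).det := by
  refine det_pow_dvd _ (univ.filter fun i : Fin (m1 + m2) => (i : ℕ) < m1)
    (univ.filter fun j : Fin (m1 + m2) => k < m1 + m2 - (j + 1)) _ _ ?_ ?_
  · intro i hi j hj
    have h1 := (mem_filter.1 hi).2
    have h2 := (mem_filter.1 hj).2
    rw [gM, Matrix.of_apply, if_pos (by omega)]
    exact Dvd.dvd.mul_right (lamA_dvd _ _ _ _ _ _ h2) _
  · have c1 : #(univ.filter fun i : Fin (m1 + m2) => (i : ℕ) < m1) = m1 := by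
      rw [Fin.card_filter_val_lt]; omega
    have c2 : #((univ.filter fun j : Fin (m1 + m2) => k < m1 + m2 - (j + 1))ᶜ) ≤ k + 1 := by
      rw [← card_range (k + 1)]
      refine card_le_card_of_injOn (fun j => m1 + m2 - (j + 1)) ?_ ?_
      · intro j hj
        simp only [coe_compl, coe_filter, mem_univ, true_and, Set.mem_compl_iff, Set.mem_ofPred_eq] at hj
        simp only [coe_range, Set.mem_Iio]
        omega
      · intro j _ j' _ h
        apply Fin.ext
        simp only at h
        omega
    omega

theorem gM_lamB [Algebra ℝ S] (m1 m2 : ℕ) (x a b : S) (Y) (k : ℕ) (hk : k < m1) :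
    lamB x b k ^ (m1 - 1 - k) ∣ (gM m1 m2 x a b Y).det := by
  refine det_pow_dvd _ (univ.filter fun i : Fin (m1 + m2) => (i : ℕ) < m1)
    (univ.filter fun j : Fin (m1 + m2) => k < j) _ _ ?_ ?_
  · intro i hi j hj
    have h1 := (mem_filter.1 hi).2
    have h2 := (mem_filter.1 hj).2
    rw [gM, Matrix.of_apply, if_pos (by omega)]
    exact Dvd.dvd.mul_right (lamB_dvd _ _ _ _ _ _ h2) _
  · have c1 : #(univ.filter fun i : Fin (m1 + m2) => (i : ℕ) < m1) = m1 := by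
      rw [Fin.card_filter_val_lt]; omega
    have c2 : #((univ.filter fun j : Fin (m1 + m2) => k < j)ᶜ) ≤ k + 1 := by
      rw [← card_range (k + 1)]
      refine card_le_card_of_injOn (fun j => j) ?_ ?_
      · intro j hj
        simp only [coe_compl, coe_filter, mem_univ, true_and, Set.mem_compl_iff, Set.mem_ofPred_eq] at hj
        simp only [coe_range, Set.mem_Iio]
        omega
      · intro j _ j' _ h
        exact Fin.ext h
    omega

theorem gM_lamQ [Algebra ℝ S] (m1 m2 : ℕ) (x a b : S) (Y) (e N : ℕ)
    (hN : N ≤ #(univ.filter fun k : Fin (m1 + m2) => (k : ℕ) ≤ e ∧ e < 2 * k)) :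
    lamQ x a b e ^ N ∣ (gM m1 m2 x a b Y).det := by
  let U : Matrix (Fin (m1 + m2)) (Fin (m1 + m2)) S := Matrix.of fun l k =>
    if l = k then 1 else if l < k ∧ (l : ℕ) + k = e then -1 else 0
  have hU : U.det = 1 := by
    rw [Matrix.det_of_isUpperTriangular]
    · simp [U]
    · intro i j hij
      simp only [id] at hij
      simp [U, hij.ne', not_lt.2 hij.le]
  rw [← mul_one (gM m1 m2 x a b Y).det, ← hU, ← Matrix.det_mul]
  refine det_pow_dvd _ univ (univ.filter fun k : Fin (m1 + m2) => (k : ℕ) ≤ e ∧ e < 2 * k) _ _ ?_ ?_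
  · intro i _ k hk
    obtain ⟨h1, h2⟩ := (mem_filter.1 hk).2
    have hs : ((gM m1 m2 x a b Y) * U) i k = gM m1 m2 x a b Y i k - gM m1 m2 x a b Y i ⟨e - k, by omega⟩ := by
      have hne : k ≠ ⟨e - k, by omega⟩ := by
        intro h
        have := congrArg Fin.val h
        simp only at this
        omega
      rw [Matrix.mul_apply, sum_eq_add k ⟨e - k, by omega⟩ hne]
      · have : (⟨e - k, by omega⟩ : Fin (m1 + m2)) < k ∧ (e - k : ℕ) + (k : ℕ) = e :=
          ⟨by rw [Fin.lt_def]; simp only; omega, by omega⟩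
        simp only [U, Matrix.of_apply, if_true, if_neg hne.symm, if_pos this]
        ring
      · intro l _ hl
        have : ¬ (l < k ∧ (l : ℕ) + k = e) := by
          rintro ⟨_, h4⟩
          apply hl.2
          apply Fin.ext
          simp only
          omega
        simp only [U, Matrix.of_apply, if_neg hl.1, if_neg this, mul_zero]
      · simp
      · simp
    rw [hs]
    obtain ⟨j, hj⟩ : ∃ j, e - (k : ℕ) = j := ⟨_, rfl⟩
    obtain rfl : j + k = e := by omega
    simp only [gM, Matrix.of_apply, hj]
    have g1 := aeval_dvd (lamQ x a b (j + k)) _ _ (Y (i + 1)) (lamQ_dvd_gt x a b j k)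
    split_ifs
    · have g2 := lamQ_dvd_gw x a b (m1 + m2) j k (by omega) k.2
      have : ∀ w w' t t' : S, w * t - w' * t' = (w - w') * t + w' * (t - t') := fun _ _ _ _ => by ring
      rw [this]
      exact dvd_add (g2.mul_right _) (g1.mul_left _)
    · simpa using g1
  · rw [card_compl]
    have := card_le_univ (univ.filter fun k : Fin (m1 + m2) => (k : ℕ) ≤ e ∧ e < 2 * k)
    rw [Finset.card_univ]
    omega

end PartD1


section PartD2

open Finset

variable {S : Type*} [CommRing S]

theorem regroup (f : ℕ → S) (n : ℕ) :
    ∏ i ∈ Icc 1 (n - 1), ∏ k ∈ range (n - i), f k = ∏ k ∈ range n, f k ^ (n - 1 - k) := by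
  rw [prod_comm' (t' := range n) (s' := fun k => Icc 1 (n - 1 - k))]
  · refine prod_congr rfl fun k _ => ?_
    rw [prod_const]; simp
  · intro i k
    simp only [mem_Icc, mem_range]
    omega

theorem gp_eq (m1 m2 : ℕ) (x a b : S) : ∃ n : ℕ, gp m1 m2 x a b =
    (-1) ^ n * ((∏ k ∈ range m1, lamA (m1 + m2) x a k ^ (m1 - 1 - k)) *
      ∏ k ∈ range m1, lamB x b k ^ (m1 - 1 - k)) := by
  refine ⟨∑ i ∈ Icc 1 (m1 - 1), (m1 - i), ?_⟩
  rw [gp, prod_mul_distrib, prod_mul_distrib, prod_pow_eq_pow_sum, ← regroup, ← regroup, mul_assoc]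
  congr 2
  refine prod_congr rfl fun i hi => ?_
  have := mem_Icc.1 hi
  obtain ⟨n, rfl⟩ := Nat.exists_eq_add_of_le (show i ≤ m1 by omega)
  rw [show i + n - i = n by omega, ← prod_range_reflect]
  refine prod_congr rfl fun k hk => ?_
  obtain ⟨r, rfl⟩ := Nat.exists_eq_add_of_lt (mem_range.1 hk)
  rw [show k + r + 1 - 1 - k = r by omega, lamB]
  push_cast; ring

/-- multiplicity of the factor `lamQ e` -/
def cq (m e : ℕ) : ℕ := #(((Icc 1 (m - 1)).sigma fun h => Icc 1 h).filter fun p => 2 * m - 1 - p.2 - p.1 = e)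

theorem gq_eq (m1 m2 : ℕ) (x a b : S) : ∃ n : ℕ, gq m1 m2 x a b =
    (-1) ^ n * ∏ e ∈ range (2 * (m1 + m2)), lamQ x a b e ^ cq (m1 + m2) e := by
  refine ⟨(m1 + m2) * (m1 + m2 - 1) / 2, ?_⟩
  rw [gq]
  congr 1
  rw [prod_sigma']
  rw [← prod_fiberwise_of_maps_to (t := range (2 * (m1 + m2)))
    (g := fun p : (_ : ℕ) × ℕ => 2 * (m1 + m2) - 1 - p.2 - p.1)]
  · refine prod_congr rfl fun e _ => ?_
    rw [cq, ← prod_const]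
    refine prod_congr rfl fun p hp => ?_
    obtain ⟨h1, h2⟩ := mem_filter.1 hp
    simp only [mem_sigma, mem_Icc] at h1
    obtain ⟨t, ht⟩ : ∃ t, 2 * (m1 + m2) = 1 + p.2 + p.1 + t := ⟨2 * (m1 + m2) - 1 - p.2 - p.1, by omega⟩
    have : e = t := by omega
    subst this
    have ht' : (2 : S) * ((m1 + m2 : ℕ) : S) = 1 + p.2 + p.1 + e := by exact_mod_cast congrArg (Nat.cast : ℕ → S) ht
    rw [lamQ]
    linear_combination (-1 : S) * ht'
  · intro p hp
    simp only [mem_sigma, mem_Icc] at hp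
    simp only [mem_range]
    omega

theorem cq_le (m e : ℕ) : cq m e ≤ #(univ.filter fun k : Fin m => (k : ℕ) ≤ e ∧ e < 2 * k) := by
  have : #(univ.filter fun k : Fin m => (k : ℕ) ≤ e ∧ e < 2 * k) = #((range m).filter fun k => k ≤ e ∧ e < 2 * k) := by
    rw [← card_map Fin.valEmbedding]
    congr 1
    ext k
    simp only [mem_map, mem_filter, mem_univ, true_and, Fin.valEmbedding_apply, mem_range]
    constructor
    · rintro ⟨k, hk, rfl⟩; exact ⟨k.2, hk⟩
    · rintro ⟨h1, h2⟩; exact ⟨⟨k, h1⟩, h2, rfl⟩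
  rw [this, cq]
  refine card_le_card_of_injOn (fun p => m - p.2) ?_ ?_
  · intro p hp
    obtain ⟨h1, h2⟩ := mem_filter.1 hp
    simp only [mem_sigma, mem_Icc] at h1
    refine mem_filter.2 ⟨mem_range.2 ?_, ?_⟩ <;> simp only <;> omega
  · rintro ⟨h, i⟩ hp ⟨h', i'⟩ hp' hh
    obtain ⟨h1, h2⟩ := mem_filter.1 hp
    obtain ⟨h1', h2'⟩ := mem_filter.1 hp'
    simp only [mem_sigma, mem_Icc] at h1 h1' h2 h2' hh
    obtain rfl : i = i' := by omega
    obtain rfl : h = h' := by omega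
    rfl

theorem relprime_lin (u v : ℝ) (hu : u ≠ 0) (hv : v ≠ 0) (r r' : ℝ[X]) (h : r ≠ r') :
    IsRelPrime (C (C u) * (X + C r) : ℝ[X][X]) (C (C v) * (X + C r')) := by
  have hU : ∀ u : ℝ, u ≠ 0 → IsUnit (C (C u) : ℝ[X][X]) := fun u hu =>
    isUnit_C.2 (isUnit_C.2 (Ne.isUnit hu))
  rw [isRelPrime_mul_unit_left_left (hU u hu), isRelPrime_mul_unit_left_right (hU v hv),
    show X + C r = X - C (-r) by simp, show X + C r' = X - C (-r') by simp]
  rw [(prime_X_sub_C (-r)).irreducible.isRelPrime_iff_not_dvd, dvd_iff_isRoot]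
  simp only [IsRoot.def, eval_sub, eval_X, eval_C]
  intro hc
  apply h
  linear_combination -hc

theorem lamQ_lin (α β : ℝ) (x a b : ℝ[X][X]) (hx : x = X)
    (ha : a = C (C α + X)) (hb : b = C (C β + C 2 * X)) (k : ℕ) :
    lamQ x a b k = C (C 2) * (X + C (C (3 / 2) * X + C ((α + β - 1 - k) / 2))) := by
  have e : (2 : ℝ[X][X]) = C (C 2) := by
    rw [show (C 2 : ℝ[X]) = 2 from map_ofNat C 2]; exact (map_ofNat C 2).symm
  have e3 : (C (C (2 : ℝ)) * C (C (3 / 2)) : ℝ[X][X]) = C (C 3) := by rw [← C_mul, ← C_mul]; norm_num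
  have e4 : (C (C (2 : ℝ)) * C (C ((α + β - 1 - k) / 2)) : ℝ[X][X]) = C (C (α + β - 1 - k)) := by
    rw [← C_mul, ← C_mul]; congr 2; ring
  have e5 : (C (C 3) : ℝ[X][X]) = C (C 2) + 1 := by
    rw [← C_1, ← C_1, ← C_add, ← C_add]; norm_num
  have e6 : (C (C (α + β - 1 - k)) : ℝ[X][X]) = C (C α) + C (C β) - 1 - k := by
    simp only [map_add, map_sub, map_natCast, map_one]
  have e7 : (C (C (3 / 2) * X + C ((α + β - 1 - k) / 2)) : ℝ[X][X]) =
    C (C (3 / 2)) * C X + C (C ((α + β - 1 - k) / 2)) := by rw [C_add, C_mul]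
  have e8 : (C (C β + C 2 * X) : ℝ[X][X]) = C (C β) + C (C 2) * C X := by rw [C_add, C_mul]
  have e9 : (C (C α + X) : ℝ[X][X]) = C (C α) + C X := by rw [C_add]
  simp only [lamQ, hx, ha, hb]
  rw [e, e7, e8, e9]
  linear_combination -(C X) * e3 - e4 - (C X) * e5 - e6

theorem sign_dvd (n n' : ℕ) (u v d : S) (h : u * v ∣ d) : (-1) ^ n * u * ((-1) ^ n' * v) ∣ d := by
  have hu : IsUnit ((-1 : S) ^ n * (-1) ^ n') := (isUnit_one.neg.pow _).mul (isUnit_one.neg.pow _)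
  rw [mul_mul_mul_comm, hu.mul_left_dvd]
  exact h

theorem combine (A B Q : ℕ → ℝ[X][X]) (d : ℝ[X][X]) (n n' : ℕ) (g c : ℕ → ℕ) (α β γ : ℝ)
    (hA : ∀ k : ℕ, A k = C (C 1) * (X + C (X + C (α + k))))
    (hB : ∀ k : ℕ, B k = C (C 1) * (X + C (C 2 * X + C (β - 1 - k))))
    (hQ : ∀ k : ℕ, Q k = C (C 2) * (X + C (C (3 / 2) * X + C ((γ - k) / 2))))
    (oA : ∀ k < n, A k ^ g k ∣ d) (oB : ∀ k < n, B k ^ g k ∣ d) (oQ : ∀ k, Q k ^ c k ∣ d) :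
    (∏ k ∈ range n, A k ^ g k) * (∏ k ∈ range n, B k ^ g k) * ∏ e ∈ range n', Q e ^ c e ∣ d := by
  have cne : ∀ (s s' t t' : ℝ), s ≠ s' ∨ t ≠ t' → (C s * X + C t : ℝ[X]) ≠ C s' * X + C t' := by
    intro s s' t t' h he
    have h1 := congrArg (fun p => coeff p 1) he
    have h0 := congrArg (fun p => coeff p 0) he
    simp [coeff_X, coeff_C] at h1 h0
    tauto
  have cne1 : ∀ (s' t t' : ℝ), 1 ≠ s' ∨ t ≠ t' → (X + C t : ℝ[X]) ≠ C s' * X + C t' := by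
    intro s' t t' h
    simpa using cne 1 s' t t' h
  have dA : ∏ k ∈ range n, A k ^ g k ∣ d := by
    refine Finset.prod_dvd_of_isRelPrime ?_ fun k hk => oA k (mem_range.1 hk)
    intro k _ k' _ hkk
    refine IsRelPrime.pow ?_
    rw [hA, hA]
    refine relprime_lin _ _ one_ne_zero one_ne_zero _ _ ?_
    intro h
    apply hkk
    simpa using h
  have dB : ∏ k ∈ range n, B k ^ g k ∣ d := by
    refine Finset.prod_dvd_of_isRelPrime ?_ fun k hk => oB k (mem_range.1 hk)
    intro k _ k' _ hkk
    refine IsRelPrime.pow ?_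
    rw [hB, hB]
    refine relprime_lin _ _ one_ne_zero one_ne_zero _ _ (cne _ _ _ _ (Or.inr ?_))
    intro h
    apply hkk
    simpa using h
  have dQ : ∏ e ∈ range n', Q e ^ c e ∣ d := by
    refine Finset.prod_dvd_of_isRelPrime ?_ fun k hk => oQ k
    intro k _ k' _ hkk
    refine IsRelPrime.pow ?_
    rw [hQ, hQ]
    refine relprime_lin _ _ two_ne_zero two_ne_zero _ _ (cne _ _ _ _ (Or.inr ?_))
    intro h
    apply hkk
    have : (k : ℝ) = k' := by linarith
    exact_mod_cast this
  have rAB : IsRelPrime (∏ k ∈ range n, A k ^ g k) (∏ k ∈ range n, B k ^ g k) := by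
    refine IsRelPrime.prod_left fun k _ => IsRelPrime.prod_right fun k' _ => IsRelPrime.pow ?_
    rw [hA, hB]
    exact relprime_lin _ _ one_ne_zero one_ne_zero _ _ (cne1 _ _ _ (Or.inl (by norm_num)))
  have rAQ : IsRelPrime (∏ k ∈ range n, A k ^ g k) (∏ e ∈ range n', Q e ^ c e) := by
    refine IsRelPrime.prod_left fun k _ => IsRelPrime.prod_right fun k' _ => IsRelPrime.pow ?_
    rw [hA, hQ]
    exact relprime_lin _ _ one_ne_zero two_ne_zero _ _ (cne1 _ _ _ (Or.inl (by norm_num)))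
  have rBQ : IsRelPrime (∏ k ∈ range n, B k ^ g k) (∏ e ∈ range n', Q e ^ c e) := by
    refine IsRelPrime.prod_left fun k _ => IsRelPrime.prod_right fun k' _ => IsRelPrime.pow ?_
    rw [hB, hQ]
    exact relprime_lin _ _ one_ne_zero two_ne_zero _ _ (cne _ _ _ _ (Or.inl (by norm_num)))
  exact (IsRelPrime.mul_left rAQ rBQ).mul_dvd (rAB.mul_dvd dA dB) dQ

theorem pq_dvd_gen (m1 m2 : ℕ) (α β : ℝ) (Y : ℕ → ℝ[X]) (x a b : ℝ[X][X]) (hx : x = X)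
    (ha : a = C (C α + X)) (hb : b = C (C β + C 2 * X)) :
    gp m1 m2 x a b * gq m1 m2 x a b ∣ (gM m1 m2 x a b Y).det := by
  obtain ⟨n, hn⟩ := gp_eq m1 m2 x a b
  obtain ⟨n', hn'⟩ := gq_eq m1 m2 x a b
  have hA : ∀ k : ℕ, lamA (m1 + m2) x a k = C (C 1) * (X + C (X + C (α - ((m1 + m2 : ℕ) : ℝ) + 1 + k))) := by
    intro k
    simp only [lamA, hx, ha, map_add, map_sub, map_natCast, map_one]; ring
  have hB : ∀ k : ℕ, lamB x b k = C (C 1) * (X + C (C 2 * X + C (β - 1 - k))) := by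
    intro k
    simp only [lamB, hx, hb, map_add, map_sub, map_mul, map_natCast, map_one]; ring
  have hQ := lamQ_lin α β x a b hx ha hb
  have fin := combine (fun k => lamA (m1 + m2) x a k) (fun k => lamB x b k) (fun k => lamQ x a b k)
    (gM m1 m2 x a b Y).det m1 (2 * (m1 + m2)) (fun k => m1 - 1 - k) (fun e => cq (m1 + m2) e)
    _ _ _ hA hB hQ (fun k hk => gM_lamA m1 m2 x a b Y k hk) (fun k hk => gM_lamB m1 m2 x a b Y k hk)
    (fun k => gM_lamQ m1 m2 x a b Y k _ (cq_le _ _))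
  rw [hn, hn']
  exact sign_dvd _ _ _ _ _ fin

theorem gw_map {T : Type*} [CommRing T] (f : S →+* T) (x a b : S) (m j : ℕ) :
    f (gw x a b m j) = gw (f x) (f a) (f b) m j := by
  simp [gw, map_prod]

theorem gt_map {T : Type*} [CommRing T] (f : S →+* T) (x a b : S) (j : ℕ) :
    f (gt x a b j) = gt (f x) (f a) (f b) j := by
  simp [gt]

theorem gp_map {T : Type*} [CommRing T] (f : S →+* T) (x a b : S) (m1 m2 : ℕ) :
    f (gp m1 m2 x a b) = gp m1 m2 (f x) (f a) (f b) := by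
  simp [gp, map_prod]

theorem gq_map {T : Type*} [CommRing T] (f : S →+* T) (x a b : S) (m1 m2 : ℕ) :
    f (gq m1 m2 x a b) = gq m1 m2 (f x) (f a) (f b) := by
  have h2 : f 2 = 2 := map_ofNat f 2
  simp [gq, map_prod, h2]

theorem gM_map {T : Type*} [CommRing T] [Algebra ℝ S] [Algebra ℝ T] (f : S →ₐ[ℝ] T) (x a b : S) (m1 m2 : ℕ) (Y) :
    f (gM m1 m2 x a b Y).det = (gM m1 m2 (f x) (f a) (f b) Y).det := by
  rw [AlgHom.map_det]
  congr 1
  ext i j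
  have h1 := gw_map f.toRingHom x a b (m1 + m2) j
  have h2 := gt_map f.toRingHom x a b j
  simp only [AlgHom.toRingHom_eq_coe, RingHom.coe_coe] at h1 h2
  simp only [gM, AlgHom.mapMatrix_apply, Matrix.map_apply, Matrix.of_apply, map_mul, ← h1, ← h2, aeval_algHom_apply]
  split_ifs <;> simp

theorem gp_real (m1 m2 : ℕ) (α β : ℝ) : gp m1 m2 (X : ℝ[X]) (C α) (C β) = ppoly m1 m2 α β := by
  simp [gp, ppoly, pochPoly]

theorem gq_real (m1 m2 : ℕ) (α β : ℝ) : gq m1 m2 (X : ℝ[X]) (C α) (C β) = qpoly m1 m2 α β := by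
  simp [gq, qpoly]

theorem gw_real (m : ℕ) (α β : ℝ) (j : ℕ) : gw (X : ℝ[X]) (C α) (C β) m j = 
    C ((-1 : ℝ) ^ (m - (j + 1))) *
      pochPoly (X + C (α - (m : ℝ) + 1)) (m - (j + 1)) *
      pochPoly (X + C (β + 1 - ((j + 1 : ℕ) : ℝ))) (j + 1 - 1) := by
  simp only [gw, pochPoly, map_pow, map_neg, map_one, map_add, map_sub, map_natCast, Nat.add_sub_cancel]

theorem gt_real (α β : ℝ) (j : ℕ) : gt (X : ℝ[X]) (C α) (C β) j = (θpoly α β).comp (X - C ((j + 1 : ℕ) : ℝ)) := by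
  simp only [gt, θpoly, mul_comp, X_comp, add_comp, C_comp, map_add, map_one, map_natCast, one_comp]

theorem gM_real0 (m1 m2 : ℕ) (α β : ℝ) (Y : ℕ → ℝ[X]) (i j) : (gM m1 m2 (X : ℝ[X]) (C α) (C β) Y) i j = entry m1 m2 α β Y ((i : ℕ) + 1) ((j : ℕ) + 1) := by
  rw [gM, Matrix.of_apply, entry, gw_real, gt_real, ← comp_eq_aeval]

theorem gM_real (m1 m2 : ℕ) (α β : ℝ) (Y : ℕ → ℝ[X])  : (gM m1 m2 (X : ℝ[X]) (C α) (C β) Y).det = Dpoly m1 m2 α β Y := by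
  have : gM m1 m2 (X : ℝ[X]) (C α) (C β) Y = Matrix.of fun i j : Fin (m1 + m2) =>
    entry m1 m2 α β Y ((i : ℕ) + 1) ((j : ℕ) + 1) := Matrix.ext fun i j => gM_real0 m1 m2 α β Y i j
  rw [this, Dpoly]

theorem pq_dvd (m1 m2 : ℕ) (α β : ℝ) (Y : ℕ → ℝ[X]) :
    ppoly m1 m2 α β * qpoly m1 m2 α β ∣ Dpoly m1 m2 α β Y := by
  have h := pq_dvd_gen m1 m2 α β Y X (C (C α + X)) (C (C β + C 2 * X)) rfl rfl rfl
  let f : ℝ[X][X] →ₐ[ℝ] ℝ[X] := mapAlgHom (aeval (0 : ℝ))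
  have h2 := map_dvd f h
  have hp := gp_map f.toRingHom (X : ℝ[X][X]) (C (C α + X)) (C (C β + C 2 * X)) m1 m2
  have hq := gq_map f.toRingHom (X : ℝ[X][X]) (C (C α + X)) (C (C β + C 2 * X)) m1 m2
  simp only [AlgHom.toRingHom_eq_coe, RingHom.coe_coe] at hp hq
  have fx : f X = X := by simp [f]
  have fa : f (C (C α + X)) = C α := by simp [f]
  have fb : f (C (C β + C 2 * X)) = C β := by simp [f]
  rw [map_mul, hp, hq, gM_map, fx, fa, fb, gp_real, gq_real, gM_real] at h2
  exact h2

end PartD2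


section PartG

open Finset

theorem prod_Icc_split (m1 m2 : ℕ) (f : ℕ → ℝ) :
    ∏ l ∈ Icc 1 (m1 + m2), f l = (∏ i : Fin m1, f (i + 1)) * ∏ i : Fin m2, f (m1 + i + 1) := by
  rw [Fin.prod_univ_eq_prod_range (fun i => f (i + 1)), Fin.prod_univ_eq_prod_range (fun i => f (m1 + i + 1)),
    ← prod_range_add (fun i => f (i + 1)), show Icc 1 (m1 + m2) = Ico 1 (m1 + m2 + 1) by ext; simp only [mem_Icc, mem_Ico]; omega,
    prod_Ico_eq_prod_range]
  refine prod_congr rfl fun i _ => ?_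
  rw [add_comm]

theorem sum_Icc_split (m1 m2 : ℕ) (f : ℕ → ℕ) :
    ∑ l ∈ Icc 1 (m1 + m2), f l = (∑ i : Fin m1, f (i + 1)) + ∑ i : Fin m2, f (m1 + i + 1) := by
  rw [show Icc 1 (m1 + m2) = Ico 1 (m1 + m2 + 1) by ext; simp only [mem_Icc, mem_Ico]; omega,
    sum_Ico_eq_sum_range, Nat.add_sub_cancel, ← Fin.sum_univ_eq_sum_range (fun i => f (1 + i)), Fin.sum_univ_add]
  simp only [Fin.val_castAdd, Fin.val_natAdd, add_comm]

theorem vand_shift (k n : ℕ) (f : ℕ → ℝ) :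
    ∏ j ∈ Icc (k + 1) (k + n), ∏ i ∈ Ico (k + 1) j, (f j - f i) =
      ∏ i : Fin n, ∏ j ∈ Ioi i, (f (k + j + 1) - f (k + i + 1)) := by
  rw [prod_Ioi_eq n (fun i j => f (k + j + 1) - f (k + i + 1)),
    show Icc (k + 1) (k + n) = Ico (k + 1) (k + n + 1) by ext; simp only [mem_Icc, mem_Ico]; omega,
    prod_Ico_eq_prod_range, show k + n + 1 - (k + 1) = n by omega]
  refine prod_congr rfl fun j _ => ?_
  rw [prod_Ico_eq_prod_range, show k + 1 + j - (k + 1) = j by omega]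
  refine prod_congr rfl fun i _ => ?_
  rw [show k + 1 + j = k + j + 1 by omega, show k + 1 + i = k + i + 1 by omega]

theorem vand_ne (k n : ℕ) (u : ℕ → ℕ) (hd : ∀ i ∈ Icc (k + 1) (k + n), ∀ j ∈ Icc (k + 1) (k + n), i ≠ j → u i ≠ u j) :
    ∏ j ∈ Icc (k + 1) (k + n), ∏ i ∈ Ico (k + 1) j, ((u j : ℝ) - u i) ≠ 0 := by
  refine prod_ne_zero_iff.2 fun j hj => prod_ne_zero_iff.2 fun i hi => ?_
  rw [sub_ne_zero, Ne, Nat.cast_inj]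
  have h1 := mem_Ico.1 hi
  have h2 := mem_Icc.1 hj
  exact hd j hj i (mem_Icc.2 ⟨h1.1, by omega⟩) (by omega)

theorem main_aux
    (m1 m2 : ℕ) (hm : 1 ≤ m1 + m2) (α β : ℝ)
    (Y : ℕ → Polynomial ℝ) (hY : ∀ l ∈ Finset.Icc 1 (m1 + m2), Y l ≠ 0)
    (hd1 : ∀ i ∈ Finset.Icc 1 m1, ∀ j ∈ Finset.Icc 1 m1, i ≠ j →
      (Y i).natDegree ≠ (Y j).natDegree)
    (hd2 : ∀ i ∈ Finset.Icc (m1 + 1) (m1 + m2), ∀ j ∈ Finset.Icc (m1 + 1) (m1 + m2),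
      i ≠ j → (Y i).natDegree ≠ (Y j).natDegree) :
    ∃ P : Polynomial ℝ,
      Dpoly m1 m2 α β Y = ppoly m1 m2 α β * qpoly m1 m2 α β * P ∧
      ((P.natDegree : ℤ) =
        2 * (∑ l ∈ Finset.Icc 1 (m1 + m2), ((Y l).natDegree : ℤ)) -
          2 * ((m1.choose 2 : ℤ) + (m2.choose 2 : ℤ))) ∧
      P.leadingCoeff =
        (∏ j ∈ Finset.Icc 1 m1, ∏ i ∈ Finset.Ico 1 j,
            (((Y j).natDegree : ℝ) - ((Y i).natDegree : ℝ))) *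
          (∏ j ∈ Finset.Icc (m1 + 1) (m1 + m2), ∏ i ∈ Finset.Ico (m1 + 1) j,
            (((Y j).natDegree : ℝ) - ((Y i).natDegree : ℝ))) *
          ∏ l ∈ Finset.Icc 1 (m1 + m2), (Y l).leadingCoeff := by
  obtain ⟨P, hP⟩ := pq_dvd m1 m2 α β Y
  refine ⟨P, hP, ?_⟩
  set V1 := (∏ j ∈ Finset.Icc 1 m1, ∏ i ∈ Finset.Ico 1 j,
            (((Y j).natDegree : ℝ) - ((Y i).natDegree : ℝ))) with hV1
  set V2 := (∏ j ∈ Finset.Icc (m1 + 1) (m1 + m2), ∏ i ∈ Finset.Ico (m1 + 1) j,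
            (((Y j).natDegree : ℝ) - ((Y i).natDegree : ℝ))) with hV2
  set R := ∏ l ∈ Finset.Icc 1 (m1 + m2), (Y l).leadingCoeff with hR
  have hV1' : V1 = ∏ j ∈ Icc (0 + 1) (0 + m1), ∏ i ∈ Ico (0 + 1) j,
      (((Y j).natDegree : ℝ) - ((Y i).natDegree : ℝ)) := by
    rw [hV1, zero_add, zero_add]
  have n1 : V1 ≠ 0 := by
    rw [hV1']
    exact vand_ne 0 m1 (fun l => (Y l).natDegree) (by rw [zero_add, zero_add]; exact hd1)
  have n2 : V2 ≠ 0 := vand_ne m1 m2 (fun l => (Y l).natDegree) hd2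
  have n3 : R ≠ 0 := prod_ne_zero_iff.2 fun l hl => leadingCoeff_ne_zero.2 (hY l hl)
  have n0 : V1 * V2 * R ≠ 0 := mul_ne_zero (mul_ne_zero n1 n2) n3
  obtain ⟨kd, kl⟩ := D_lead m1 m2 hm α β Y V1 V2 R
    (by rw [hV1', vand_shift 0 m1 (fun l => ((Y l).natDegree : ℝ))]; simp only [zero_add])
    (by rw [hV2, vand_shift m1 m2 (fun l => ((Y l).natDegree : ℝ))])
    (prod_Icc_split m1 m2 fun l => (Y l).leadingCoeff) n0
  rw [← sum_Icc_split m1 m2 fun l => (Y l).natDegree] at kd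
  obtain ⟨pd, pl⟩ := ppoly_lead m1 m2 α β
  obtain ⟨qd, ql⟩ := qpoly_lead m1 m2 α β
  have hD0 : Dpoly m1 m2 α β Y ≠ 0 := by
    rw [← leadingCoeff_ne_zero, kl]
    exact mul_ne_zero (by positivity) n0
  have hp0 : ppoly m1 m2 α β ≠ 0 := by rintro h; simp [h] at hP; exact hD0 hP
  have hq0 : qpoly m1 m2 α β ≠ 0 := by rintro h; simp [h] at hP; exact hD0 hP
  have hP0 : P ≠ 0 := by rintro h; simp [h] at hP; exact hD0 hP
  have ha : m1 * (m1 + m2 - 1) = 2 * m1.choose 2 + m1 * m2 := by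
    rw [← T_two]
    cases m1 with
    | zero => simp
    | succ k => rw [show k + 1 + m2 - 1 = k + m2 by omega, Nat.add_sub_cancel]; ring
  have hta := T_add m1 m2
  constructor
  · rw [hP, natDegree_mul (mul_ne_zero hp0 hq0) hP0, natDegree_mul hp0 hq0, pd, qd] at kd
    have hc := mul_comm m1 m2
    have : P.natDegree + 2 * (m1.choose 2 + m2.choose 2) = 2 * ∑ l ∈ Icc 1 (m1 + m2), (Y l).natDegree := by
      omega
    zify at this
    linarith
  · rw [hP, leadingCoeff_mul, leadingCoeff_mul, pl, ql] at kl
    have e : m1 * (m1 + m2 - 1) + m2.choose 2 = m1.choose 2 + (m1 + m2).choose 2 := by omega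
    rw [e, pow_add, ← mul_assoc] at kl
    exact mul_left_cancel₀ (by positivity) kl

end PartG


/-- **Lemma A.1 (lgp1), exact degree and leading coefficient.** If the degrees
`u_1,…,u_{m1}` are pairwise distinct and the degrees `u_{m1+1},…,u_m` are pairwise
distinct, then `P = D/(pq)` has degree exactly `2 Σᵢ uᵢ - 2(C(m1,2)+C(m2,2))` and
leading coefficient `V(u_1,…,u_{m1}) V(u_{m1+1},…,u_m) Πᵢ rᵢ`. -/
theorem casorati_quotient_degree_eq
    (m1 m2 : ℕ) (hm : 1 ≤ m1 + m2) (α β : ℝ)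
    (Y : ℕ → Polynomial ℝ) (hY : ∀ l ∈ Finset.Icc 1 (m1 + m2), Y l ≠ 0)
    (hd1 : ∀ i ∈ Finset.Icc 1 m1, ∀ j ∈ Finset.Icc 1 m1, i ≠ j →
      (Y i).natDegree ≠ (Y j).natDegree)
    (hd2 : ∀ i ∈ Finset.Icc (m1 + 1) (m1 + m2), ∀ j ∈ Finset.Icc (m1 + 1) (m1 + m2),
      i ≠ j → (Y i).natDegree ≠ (Y j).natDegree) :
    ∃ P : Polynomial ℝ,
      Dpoly m1 m2 α β Y = ppoly m1 m2 α β * qpoly m1 m2 α β * P ∧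
      ((P.natDegree : ℤ) =
        2 * (∑ l ∈ Finset.Icc 1 (m1 + m2), ((Y l).natDegree : ℤ)) -
          2 * ((m1.choose 2 : ℤ) + (m2.choose 2 : ℤ))) ∧
      P.leadingCoeff =
        (∏ j ∈ Finset.Icc 1 m1, ∏ i ∈ Finset.Ico 1 j,
            (((Y j).natDegree : ℝ) - ((Y i).natDegree : ℝ))) *
          (∏ j ∈ Finset.Icc (m1 + 1) (m1 + m2), ∏ i ∈ Finset.Ico (m1 + 1) j,
            (((Y j).natDegree : ℝ) - ((Y i).natDegree : ℝ))) *
          ∏ l ∈ Finset.Icc 1 (m1 + m2), (Y l).leadingCoeff := by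
  exact main_aux m1 m2 hm α β Y hY hd1 hd2
end

section
/- Let α be a positive integer and M > 0. Let (q_n)_{n≥0}, deg q_n = n, be a sequence of orthogonal polynomials with respect to the positive-definite inner product ⟨p,q⟩ = ∫_{−1}^{1} p(x)q(x)(1−x²)^{α−1} dx + M( p(−1)q(−1) + p(1)q(1) ) (i.e. with respect to the Gegenbauer-type measure (1−x²)^{α−1}dx on (−1,1) plus M(δ_{−1}+δ_{1})); such a sequence exists. Then there exist real polynomials f_0, …, f_{2α+2} with deg f_j ≤ j and f_{2α+2} ≠ 0 such that Σ_{j=0}^{2α+2} f_j·q_n^{(j)} = λ_n·q_n for all n ≥ 0, where one may take λ_n = 4^{α−1}(α−1)!·n(n+2α−1) + M·(n−1)_{2α+2}/(2(α+1)!); that is, the q_n are eigenfunctions of a differential operator of order 2α+2. -/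
open Polynomial

/-- Pochhammer symbol `(a)_k = a (a+1) ⋯ (a+k-1)`. -/
noncomputable def poch (a : ℝ) (k : ℕ) : ℝ := ∏ i ∈ Finset.range k, (a + i)

/-- A sequence of (left) orthogonal polynomials with respect to a bilinear form. -/
def IsLeftOrthoSeq (B : Polynomial ℝ → Polynomial ℝ → ℝ) (q : ℕ → Polynomial ℝ) : Prop :=
  (∀ n : ℕ, (q n).degree = (n : ℕ)) ∧
    (∀ n : ℕ, ∀ r : Polynomial ℝ, r.degree < (n : ℕ) → B (q n) r = 0) ∧
    ∀ n : ℕ, B (q n) (q n) ≠ 0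

/-- The Gegenbauer-type inner product `(1-x²)^{α-1}dx + M(δ_{-1}+δ_1)`. -/
noncomputable def gegenBilin (α : ℕ) (M : ℝ) (p q : Polynomial ℝ) : ℝ :=
  (∫ x in Set.Ioo (-1 : ℝ) 1, p.eval x * q.eval x * (1 - x ^ 2) ^ (α - 1)) +
    M * (p.eval (-1) * q.eval (-1) + p.eval 1 * q.eval 1)


namespace GegenAux

/-- Evaluation of an iterated derivative through the Taylor coefficients. -/
lemma eval_iter (c : ℝ) (n : ℕ) (f : ℝ[X]) :
    (derivative^[n] f).eval c = (n.factorial : ℝ) * (taylor c f).coeff n := by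
  rw [taylor_coeff, ← factorial_smul_hasseDeriv]
  simp

lemma taylor_mul_pow (c : ℝ) (k : ℕ) (g : ℝ[X]) :
    taylor c ((X - C c) ^ k * g) = X ^ k * taylor c g := by
  rw [taylor_mul, taylor_pow]
  simp

lemma eval_iter_lt (c : ℝ) (k j : ℕ) (hj : j < k) (g : ℝ[X]) :
    (derivative^[j] ((X - C c) ^ k * g)).eval c = 0 := by
  rw [eval_iter, taylor_mul_pow, coeff_X_pow_mul', if_neg (by omega), mul_zero]

lemma eval_iter_eq (c : ℝ) (k : ℕ) (g : ℝ[X]) :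
    (derivative^[k] ((X - C c) ^ k * g)).eval c = (k.factorial : ℝ) * g.eval c := by
  rw [eval_iter, taylor_mul_pow, coeff_X_pow_mul', if_pos le_rfl, Nat.sub_self, taylor_coeff_zero]

lemma eval_iter_succ (c : ℝ) (k : ℕ) (g : ℝ[X]) :
    (derivative^[k + 1] ((X - C c) ^ k * g)).eval c =
      ((k + 1).factorial : ℝ) * (derivative g).eval c := by
  rw [eval_iter, taylor_mul_pow, coeff_X_pow_mul', if_pos (by omega), Nat.add_sub_cancel_left,
    taylor_coeff_one]

/-- The integral of a polynomial over `[-1,1]`. -/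
noncomputable def I (p : ℝ[X]) : ℝ := ∫ x in (-1 : ℝ)..1, p.eval x

lemma I_add (p q : ℝ[X]) : I (p + q) = I p + I q := by
  unfold I
  simp only [eval_add]
  exact intervalIntegral.integral_add (p.continuous.intervalIntegrable _ _)
    (q.continuous.intervalIntegrable _ _)

lemma I_C_mul (a : ℝ) (p : ℝ[X]) : I (C a * p) = a * I p := by
  unfold I
  simp only [eval_mul, eval_C]
  exact intervalIntegral.integral_const_mul _ _

lemma I_sub (p q : ℝ[X]) : I (p - q) = I p - I q := by
  have h : p - q = p + C (-1) * q := by simp [sub_eq_add_neg]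
  rw [h, I_add, I_C_mul]; ring

lemma I_deriv (p : ℝ[X]) : I (derivative p) = p.eval 1 - p.eval (-1) := by
  unfold I
  exact intervalIntegral.integral_eq_sub_of_hasDerivAt (fun x _ => p.hasDerivAt x)
    ((derivative p).continuous.intervalIntegrable _ _)

lemma bilin_eq (α : ℕ) (M : ℝ) (p q : ℝ[X]) :
    gegenBilin α M p q = I (p * q * (1 - X ^ 2) ^ (α - 1)) +
      M * (p.eval (-1) * q.eval (-1) + p.eval 1 * q.eval 1) := by
  unfold gegenBilin I
  rw [intervalIntegral.integral_of_le (by norm_num), MeasureTheory.integral_Ioc_eq_integral_Ioo]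
  simp

/-- Repeated integration by parts. -/
lemma I_parts (u v : ℝ[X]) (N : ℕ) : ∀ k : ℕ,
    (∀ j < k, (derivative^[j] v).eval 1 = 0 ∧ (derivative^[j] v).eval (-1) = 0) →
    I (derivative^[N + k] u * v) = (-1) ^ k * I (derivative^[N] u * derivative^[k] v) := by
  intro k
  induction k generalizing N with
  | zero => intro _; simp
  | succ k ih =>
    intro h
    have h1 := ih (N + 1) (fun j hj => h j (by omega))
    have e : N + (k + 1) = N + 1 + k := by ring
    rw [e, h1]
    have h2 := I_deriv (derivative^[N] u * derivative^[k] v)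
    rw [derivative_mul, ← Function.iterate_succ_apply' derivative, ← Function.iterate_succ_apply' derivative, I_add,
      eval_mul, eval_mul, (h k (by omega)).1, (h k (by omega)).2] at h2
    have h3 : I (derivative^[N + 1] u * derivative^[k] v) =
      - I (derivative^[N] u * derivative^[k + 1] v) := by simp only [Nat.succ_eq_add_one] at h2; linarith
    rw [h3]; ring

lemma V_one (α : ℕ) (p : ℝ[X]) :
    (X ^ 2 - 1) ^ α * p = (X - C 1) ^ α * ((X + 1) ^ α * p) := by
  rw [← mul_assoc, ← mul_pow]; congr 2; simp; ring

lemma V_neg (α : ℕ) (p : ℝ[X]) :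
    (X ^ 2 - 1) ^ α * p = (X - C (-1)) ^ α * ((X - 1) ^ α * p) := by
  rw [← mul_assoc, ← mul_pow]; congr 2; simp; ring

lemma V_vanish (α : ℕ) (p : ℝ[X]) : ∀ j < α,
    (derivative^[j] ((X ^ 2 - 1) ^ α * p)).eval 1 = 0 ∧
    (derivative^[j] ((X ^ 2 - 1) ^ α * p)).eval (-1) = 0 := by
  intro j hj
  constructor
  · rw [V_one]; exact eval_iter_lt _ _ _ hj _
  · rw [V_neg]; exact eval_iter_lt _ _ _ hj _

/-- The boundary term at a point. -/
lemma wronski (c : ℝ) (k : ℕ) (s p r : ℝ[X]) :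
    (derivative^[k + 1] ((X - C c) ^ k * (s * p))).eval c *
        (derivative^[k] ((X - C c) ^ k * (s * r))).eval c -
      (derivative^[k] ((X - C c) ^ k * (s * p))).eval c *
        (derivative^[k + 1] ((X - C c) ^ k * (s * r))).eval c =
    (k.factorial : ℝ) * ((k + 1).factorial : ℝ) * (s.eval c) ^ 2 *
      ((derivative p).eval c * r.eval c - p.eval c * (derivative r).eval c) := by
  simp only [eval_iter_eq, eval_iter_succ, derivative_mul, eval_add, eval_mul]
  ring

lemma T_sym (α : ℕ) (p r : ℝ[X]) :
    I (derivative^[2 * α + 2] ((X ^ 2 - 1) ^ α * p) * ((X ^ 2 - 1) ^ α * r)) -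
      I (derivative^[2 * α + 2] ((X ^ 2 - 1) ^ α * r) * ((X ^ 2 - 1) ^ α * p)) =
    (-1) ^ α * ((α.factorial : ℝ) * ((α + 1).factorial : ℝ) * 4 ^ α) *
      (((derivative p).eval 1 * r.eval 1 - p.eval 1 * (derivative r).eval 1) -
       ((derivative p).eval (-1) * r.eval (-1) - p.eval (-1) * (derivative r).eval (-1))) := by
  have e : 2 * α + 2 = (α + 2) + α := by ring
  rw [e, I_parts _ _ (α + 2) α (V_vanish α r), I_parts _ _ (α + 2) α (V_vanish α p)]
  have w1 := wronski 1 α ((X + 1) ^ α) p r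
  have w2 := wronski (-1) α ((X - 1) ^ α) p r
  rw [← V_one, ← V_one] at w1
  rw [← V_neg, ← V_neg] at w2
  set a := derivative^[α] ((X ^ 2 - 1) ^ α * p) with ha
  set b := derivative^[α] ((X ^ 2 - 1) ^ α * r) with hb
  have ia : ∀ f : ℝ[X], derivative^[α + 1] f = derivative (derivative^[α] f) := fun f =>
    Function.iterate_succ_apply' _ _ _
  have ia2 : ∀ f : ℝ[X], derivative^[α + 2] f = derivative (derivative (derivative^[α] f)) :=
    fun f => by rw [Function.iterate_succ_apply', Function.iterate_succ_apply']
  rw [ia, ia] at w1 w2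
  rw [ia2, ia2]
  rw [← ha, ← hb] at *
  have h := I_deriv (derivative a * b - a * derivative b)
  have h' : derivative (derivative a * b - a * derivative b) =
      derivative (derivative a) * b - derivative (derivative b) * a := by
    simp only [derivative_sub, derivative_mul]; ring
  rw [h', I_sub] at h
  simp only [eval_sub, eval_mul] at h
  have s1 : (((X + 1) ^ α : ℝ[X]).eval 1) ^ 2 = 4 ^ α := by
    simp only [eval_pow, eval_add, eval_X, eval_one]
    rw [← pow_mul, mul_comm, pow_mul]; norm_num
  have s2 : (((X - 1) ^ α : ℝ[X]).eval (-1)) ^ 2 = 4 ^ α := by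
    simp only [eval_pow, eval_sub, eval_X, eval_one]
    rw [← pow_mul, mul_comm, pow_mul]; norm_num
  rw [s1] at w1
  rw [s2] at w2
  rw [← mul_sub, h, w1, w2]
  ring

lemma L_sym (α : ℕ) (hα : 0 < α) (p r : ℝ[X]) :
    I (((X ^ 2 - 1) * derivative (derivative p) + C (2 * (α : ℝ)) * X * derivative p) * r *
        (1 - X ^ 2) ^ (α - 1)) =
    I (((X ^ 2 - 1) * derivative (derivative r) + C (2 * (α : ℝ)) * X * derivative r) * p *
        (1 - X ^ 2) ^ (α - 1)) := by
  obtain ⟨a, rfl⟩ : ∃ a, α = a + 1 := ⟨α - 1, by omega⟩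
  rw [← sub_eq_zero, ← I_sub]
  have h := I_deriv ((1 - X ^ 2) ^ (a + 1) * (p * derivative r - derivative p * r))
  have z1 : ((1 - X ^ 2 : ℝ[X]) ^ (a + 1)).eval 1 = 0 := by simp
  have z2 : ((1 - X ^ 2 : ℝ[X]) ^ (a + 1)).eval (-1) = 0 := by simp
  rw [eval_mul, eval_mul, z1, z2] at h
  simp only [zero_mul, sub_zero] at h
  rw [← h]
  congr 1
  simp only [derivative_mul, derivative_sub, derivative_pow, derivative_X, derivative_one,
    Nat.add_sub_cancel, map_mul, map_ofNat, map_natCast]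
  push_cast
  ring

/-- The differential operator. -/
noncomputable def D (α : ℕ) (c k : ℝ) (p : ℝ[X]) : ℝ[X] :=
  C c * ((X ^ 2 - 1) * derivative (derivative p) + C (2 * (α : ℝ)) * X * derivative p) +
    C k * ((X ^ 2 - 1) * derivative^[2 * α + 2] ((X ^ 2 - 1) ^ α * p))

lemma D_sym (α : ℕ) (hα : 0 < α) (M c k : ℝ)
    (hck : M * c * (2 * α) = k * ((α.factorial : ℝ) * ((α + 1).factorial : ℝ) * 4 ^ α))
    (p r : ℝ[X]) : gegenBilin α M (D α c k p) r = gegenBilin α M p (D α c k r) := by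
  have key : ∀ p r : ℝ[X], gegenBilin α M (D α c k p) r =
      c * I (((X ^ 2 - 1) * derivative (derivative p) + C (2 * (α : ℝ)) * X * derivative p) * r *
        (1 - X ^ 2) ^ (α - 1)) +
      k * (-1) ^ (α - 1) *
        I (derivative^[2 * α + 2] ((X ^ 2 - 1) ^ α * p) * ((X ^ 2 - 1) ^ α * r)) +
      M * c * (2 * α) * ((derivative p).eval 1 * r.eval 1 -
        (derivative p).eval (-1) * r.eval (-1)) := by
    intro p r
    rw [bilin_eq, mul_assoc k, ← I_C_mul, ← I_C_mul, ← I_C_mul, ← I_add]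
    obtain ⟨a, rfl⟩ : ∃ a, α = a + 1 := ⟨α - 1, by omega⟩
    have hw : (X ^ 2 - 1 : ℝ[X]) ^ (a + 1) = C ((-1) ^ a) * (1 - X ^ 2) ^ a * (X ^ 2 - 1) := by
      rw [pow_succ]; congr 1
      rw [map_pow, ← mul_pow]; congr 1; simp
    have hs : (C ((-1) ^ a) * C ((-1) ^ a) : ℝ[X]) = 1 := by
      rw [← map_mul, ← mul_pow]; simp
    rw [Nat.add_sub_cancel]
    congr 1
    · congr 1
      unfold D
      generalize derivative^[2 * (a + 1) + 2] ((X ^ 2 - 1) ^ (a + 1) * p) = W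
      rw [hw]
      linear_combination (-(C k * W * r * (1 - X ^ 2) ^ a * (X ^ 2 - 1))) * hs
    · unfold D
      simp only [eval_add, eval_mul, eval_sub, eval_pow, eval_X, eval_one, eval_C]
      ring
  have hcomm : gegenBilin α M p (D α c k r) = gegenBilin α M (D α c k r) p := by
    rw [bilin_eq, bilin_eq, mul_comm p]; ring
  rw [hcomm, key, key, L_sym α hα p r]
  have ht := T_sym α p r
  have hs : (-1 : ℝ) ^ (α - 1) * (-1) ^ α = -1 := by
    obtain ⟨a, rfl⟩ : ∃ a, α = a + 1 := ⟨α - 1, by omega⟩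
    rw [Nat.add_sub_cancel, pow_succ, ← mul_assoc, ← mul_pow]; simp
  rw [hck]
  linear_combination (k * (-1) ^ (α - 1)) * ht + k * ((α.factorial : ℝ) * ((α + 1).factorial : ℝ) * 4 ^ α) *
      (((derivative p).eval 1 * r.eval 1 - p.eval 1 * (derivative r).eval 1) -
       ((derivative p).eval (-1) * r.eval (-1) - p.eval (-1) * (derivative r).eval (-1))) * hs

lemma natDegree_V (α : ℕ) : ((X ^ 2 - 1 : ℝ[X]) ^ α).natDegree ≤ 2 * α := by
  have : (X ^ 2 - 1 : ℝ[X]).natDegree ≤ 2 := by compute_degree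
  calc _ ≤ α * (X ^ 2 - 1 : ℝ[X]).natDegree := natDegree_pow_le
    _ ≤ 2 * α := by nlinarith

lemma coeff_V (α : ℕ) : ((X ^ 2 - 1 : ℝ[X]) ^ α).coeff (2 * α) = 1 := by
  have : (X ^ 2 - 1 : ℝ[X]).natDegree ≤ 2 := by compute_degree
  rw [mul_comm, coeff_pow_of_natDegree_le this]
  simp [coeff_one]

lemma poch_eq (k N : ℕ) : poch (((k + 2 : ℕ) : ℝ) - 1) N = ((k + N).descFactorial N : ℝ) := by
  rw [Nat.add_descFactorial_eq_ascFactorial, Nat.ascFactorial_eq_prod_range]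
  unfold poch
  push_cast
  apply Finset.prod_congr rfl
  intro i _
  ring

lemma coeff_L (α m : ℕ) (p : ℝ[X]) (hp : p.natDegree ≤ m) :
    ((X ^ 2 - 1) * derivative (derivative p) + C (2 * (α : ℝ)) * X * derivative p).coeff m =
      (m : ℝ) * ((m : ℝ) + 2 * α - 1) * p.coeff m := by
  have z1 : p.coeff (m + 2) = 0 := coeff_eq_zero_of_natDegree_lt (by omega)
  rw [sub_mul, one_mul, mul_assoc (C _), coeff_add, coeff_sub, coeff_C_mul]
  rcases m with _ | _ | k
  · simp [coeff_X_pow_mul', coeff_derivative] at *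
    simp [z1]
  · simp [coeff_X_pow_mul', coeff_derivative, coeff_X_mul] at *
    simp [z1]
  · rw [coeff_X_pow_mul, coeff_X_mul]
    simp only [coeff_derivative]
    rw [z1]
    push_cast
    ring

lemma coeff_T (α m : ℕ) (p : ℝ[X]) (hp : p.natDegree ≤ m) :
    ((X ^ 2 - 1) * derivative^[2 * α + 2] ((X ^ 2 - 1) ^ α * p)).coeff m =
      poch ((m : ℝ) - 1) (2 * α + 2) * p.coeff m := by
  have hd : ((X ^ 2 - 1 : ℝ[X]) ^ α * p).natDegree ≤ 2 * α + m :=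
    natDegree_mul_le_of_le (natDegree_V α) hp
  have hz : (derivative^[2 * α + 2] ((X ^ 2 - 1 : ℝ[X]) ^ α * p)).coeff m = 0 := by
    rw [coeff_iterate_derivative, coeff_eq_zero_of_natDegree_lt (by omega), smul_zero]
  rw [sub_mul, one_mul, coeff_sub, hz, sub_zero]
  rcases m with _ | _ | k
  · rw [coeff_X_pow_mul', if_neg (by omega)]
    have : poch (((0 : ℕ) : ℝ) - 1) (2 * α + 2) = 0 := by
      unfold poch
      exact Finset.prod_eq_zero (i := 1) (by simp) (by simp)
    rw [this, zero_mul]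
  · rw [coeff_X_pow_mul', if_neg (by omega)]
    have : poch (((0 + 1 : ℕ) : ℝ) - 1) (2 * α + 2) = 0 := by
      unfold poch
      exact Finset.prod_eq_zero (i := 0) (by simp) (by simp)
    rw [this, zero_mul]
  · rw [coeff_X_pow_mul, coeff_iterate_derivative, poch_eq, nsmul_eq_mul]
    have e : k + (2 * α + 2) = 2 * α + (k + 1 + 1) := by ring
    rw [e, coeff_mul_add_eq_of_natDegree_le (natDegree_V α) hp, coeff_V, one_mul]

lemma coeff_D (α m : ℕ) (c k : ℝ) (p : ℝ[X]) (hp : p.natDegree ≤ m) :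
    (D α c k p).coeff m =
      (c * m * ((m : ℝ) + 2 * α - 1) + k * poch ((m : ℝ) - 1) (2 * α + 2)) * p.coeff m := by
  unfold D
  rw [coeff_add, coeff_C_mul, coeff_C_mul, coeff_L α m p hp, coeff_T α m p hp]
  ring

/-- The coefficients of the operator. -/
noncomputable def F (α : ℕ) (c k : ℝ) (j : ℕ) : ℝ[X] :=
  (if j = 2 then C c * (X ^ 2 - 1) else 0) + (if j = 1 then C c * (C (2 * (α : ℝ)) * X) else 0) +
    C k * ((X ^ 2 - 1) * (((2 * α + 2).choose j : ℝ[X]) *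
      derivative^[2 * α + 2 - j] ((X ^ 2 - 1) ^ α)))

lemma F_sum (α : ℕ) (c k : ℝ) (p : ℝ[X]) :
    ∑ j ∈ Finset.range (2 * α + 3), F α c k j * derivative^[j] p = D α c k p := by
  unfold F D
  simp only [add_mul, Finset.sum_add_distrib, ite_mul, zero_mul, Finset.sum_ite_eq']
  rw [if_pos (by simp), if_pos (by simp), iterate_derivative_mul]
  simp only [Function.iterate_succ, Function.iterate_zero, Function.comp, id, Finset.mul_sum,
    nsmul_eq_mul]
  rw [mul_add]
  congr 1
  · ring
  · apply Finset.sum_congr rfl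
    intro j _
    ring

lemma F_deg (α : ℕ) (c k : ℝ) (j : ℕ) (hj : j ≤ 2 * α + 2) :
    (F α c k j).degree ≤ (j : ℕ) := by
  rw [← natDegree_le_iff_degree_le]
  unfold F
  have h2 : (X ^ 2 - 1 : ℝ[X]).natDegree ≤ 2 := by compute_degree
  refine natDegree_add_le_of_degree_le (natDegree_add_le_of_degree_le ?_ ?_) ?_
  · split_ifs with h
    · subst h; exact (natDegree_C_mul_le _ _).trans h2
    · simp
  · split_ifs with h
    · subst h
      exact (natDegree_C_mul_le _ _).trans ((natDegree_C_mul_le _ _).trans natDegree_X_le)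
    · simp
  · refine (natDegree_C_mul_le _ _).trans ?_
    by_cases h : 2 * α < 2 * α + 2 - j
    · rw [iterate_derivative_eq_zero ((natDegree_V α).trans_lt h)]
      simp
    · have h3 := (natDegree_iterate_derivative ((X ^ 2 - 1 : ℝ[X]) ^ α) (2 * α + 2 - j)).trans
        (Nat.sub_le_sub_right (natDegree_V α) _)
      have h4 : (((2 * α + 2).choose j : ℝ[X])).natDegree ≤ 0 := (natDegree_natCast _).le
      refine (natDegree_mul_le_of_le h2 (natDegree_mul_le_of_le h4 h3)).trans ?_
      omega

lemma F_ne (α : ℕ) (hα : 0 < α) (c k : ℝ) (hk : k ≠ 0) : F α c k (2 * α + 2) ≠ 0 := by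
  unfold F
  rw [if_neg (by omega), if_neg (by omega)]
  have h : (X ^ 2 - 1 : ℝ[X]) ≠ 0 := by
    intro h
    have := congrArg (eval 0) h
    simp at this
  simp only [Nat.choose_self, Nat.sub_self, Function.iterate_zero, id, zero_add, Nat.cast_one,
    one_mul]
  exact mul_ne_zero (C_ne_zero.mpr hk) (mul_ne_zero h (pow_ne_zero _ h))

lemma bilin_comm (α : ℕ) (M : ℝ) (p q : ℝ[X]) : gegenBilin α M p q = gegenBilin α M q p := by
  rw [bilin_eq, bilin_eq, mul_comm p]; ring

lemma bilin_comb (α : ℕ) (M a : ℝ) (p s r : ℝ[X]) :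
    gegenBilin α M (p - C a * s) r = gegenBilin α M p r - a * gegenBilin α M s r := by
  have e : (p - C a * s) * r * (1 - X ^ 2) ^ (α - 1) =
    p * r * (1 - X ^ 2) ^ (α - 1) - C a * (s * r * (1 - X ^ 2) ^ (α - 1)) := by ring
  rw [bilin_eq, bilin_eq, bilin_eq, e, I_sub, I_C_mul]
  simp only [eval_sub, eval_mul, eval_C]
  ring

lemma deg_lt_of {n : ℕ} {p : ℝ[X]} (h : ∀ m ≥ n, p.coeff m = 0) : p.degree < (n : ℕ) := by
  rw [degree_lt_iff_coeff_zero]; exact h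

/-- A polynomial of degree `< n` orthogonal to all polynomials of degree `< n` vanishes. -/
lemma eq_zero_of_ortho (α : ℕ) (M : ℝ) (q : ℕ → ℝ[X]) (hq : IsLeftOrthoSeq (gegenBilin α M) q)
    (n : ℕ) (e : ℝ[X]) (he : e.degree < (n : ℕ))
    (ho : ∀ r : ℝ[X], r.degree < (n : ℕ) → gegenBilin α M e r = 0) : e = 0 := by
  obtain ⟨h1, h2, h3⟩ := hq
  by_contra hne
  set m := e.natDegree with hm
  have hdeg : e.degree = (m : ℕ) := degree_eq_natDegree hne
  have hmn : m < n := by rw [hdeg] at he; exact_mod_cast he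
  have hqm : (q m) ≠ 0 := by
    intro h; have := h1 m; rw [h] at this; simp at this
  have hln : (q m).natDegree = m := natDegree_eq_of_degree_eq_some (h1 m)
  have hlc : (q m).coeff m ≠ 0 := by
    have := leadingCoeff_ne_zero.mpr hqm
    rwa [leadingCoeff, hln] at this
  have hec : e.coeff m ≠ 0 := leadingCoeff_ne_zero.mpr hne
  have hs : (e - C (e.coeff m / (q m).coeff m) * q m).degree < (m : ℕ) := by
    apply deg_lt_of
    intro j hj
    rw [coeff_sub, coeff_C_mul]
    rcases hj.eq_or_lt with h | h
    · rw [← h]; field_simp; ring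
    · rw [coeff_eq_zero_of_natDegree_lt (p := e) h,
        coeff_eq_zero_of_natDegree_lt (p := q m) (n := j) (by rw [hln]; exact h)]
      ring
  have h4 := h2 m _ hs
  rw [bilin_comm, bilin_comb, ho _ (by rw [h1 m]; exact_mod_cast hmn)] at h4
  have : e.coeff m / (q m).coeff m * gegenBilin α M (q m) (q m) ≠ 0 :=
    mul_ne_zero (div_ne_zero hec hlc) (h3 m)
  apply this
  linarith

end GegenAux

open GegenAux in
/-- **Koekoek's example.** Orthogonal polynomials with respect to the Gegenbauer-type
measure `(1-x²)^{α-1}dx + M(δ_{-1}+δ_1)` exist and are eigenfunctions of a differential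
operator of order `2α+2`, with eigenvalues
`λ_n = 4^{α-1}(α-1)! n(n+2α-1) + M (n-1)_{2α+2}/(2(α+1)!)`. -/
theorem gegenbauer_type_order (α : ℕ) (hα : 0 < α) (M : ℝ) (hM : 0 < M)
    (q : ℕ → Polynomial ℝ) (hq : IsLeftOrthoSeq (gegenBilin α M) q) :
    (∃ qs : ℕ → Polynomial ℝ, IsLeftOrthoSeq (gegenBilin α M) qs) ∧
    ∃ f : ℕ → Polynomial ℝ,
      (∀ j ≤ 2 * α + 2, (f j).degree ≤ (j : ℕ)) ∧ f (2 * α + 2) ≠ 0 ∧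
      ∀ n : ℕ,
        ∑ j ∈ Finset.range (2 * α + 3), f j * (⇑Polynomial.derivative)^[j] (q n) =
          ((4 : ℝ) ^ (α - 1) * (Nat.factorial (α - 1) : ℝ) * (n : ℝ) *
              ((n : ℝ) + 2 * (α : ℝ) - 1) +
            M * poch ((n : ℝ) - 1) (2 * α + 2) / (2 * (Nat.factorial (α + 1) : ℝ))) •
          q n := by
  refine ⟨⟨q, hq⟩, ?_⟩
  set c : ℝ := (4 : ℝ) ^ (α - 1) * (Nat.factorial (α - 1) : ℝ) with hc
  set k : ℝ := M / (2 * (Nat.factorial (α + 1) : ℝ)) with hk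
  have hfac : (Nat.factorial (α + 1) : ℝ) ≠ 0 := by positivity
  have hk0 : k ≠ 0 := by rw [hk]; positivity
  have hck : M * c * (2 * α) = k * ((α.factorial : ℝ) * ((α + 1).factorial : ℝ) * 4 ^ α) := by
    rw [hc, hk]
    obtain ⟨a, rfl⟩ : ∃ a, α = a + 1 := ⟨α - 1, by omega⟩
    rw [Nat.add_sub_cancel, Nat.factorial_succ a, pow_succ]
    push_cast
    field_simp
    ring
  refine ⟨F α c k, F_deg α c k, F_ne α hα c k hk0, ?_⟩
  intro n
  rw [F_sum]
  have hlam : M * poch ((n : ℝ) - 1) (2 * α + 2) / (2 * (Nat.factorial (α + 1) : ℝ)) =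
      k * poch ((n : ℝ) - 1) (2 * α + 2) := by rw [hk]; ring
  rw [hlam, smul_eq_C_mul, ← sub_eq_zero]
  set l : ℝ := c * n * ((n : ℝ) + 2 * α - 1) + k * poch ((n : ℝ) - 1) (2 * α + 2) with hl
  have hln : (q n).natDegree = n := natDegree_eq_of_degree_eq_some (hq.1 n)
  apply eq_zero_of_ortho α M q hq n
  · apply deg_lt_of
    intro m hm
    rw [coeff_sub, coeff_C_mul, coeff_D α m c k _ (by omega)]
    rcases hm.eq_or_lt with h | h
    · rw [← h]; ring
    · rw [coeff_eq_zero_of_natDegree_lt (by omega)]; ring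
  · intro r hr
    rw [bilin_comb, D_sym α hα M c k hck, hq.2.1 n r hr, hq.2.1 n]
    · ring
    · apply deg_lt_of
      intro m hm
      have hz := (degree_lt_iff_coeff_zero r n).mp hr
      have hrd : r.natDegree ≤ m := by
        rw [natDegree_le_iff_coeff_eq_zero]
        intro j hj
        exact hz j (by omega)
      rw [coeff_D α m c k r hrd, hz m hm, mul_zero]
end

section
/- Let α ≥ 2 be an integer and let M0, M1 be real numbers with M1 ≠ 0 and M0 ≠ M1. Consider the (non-symmetric) bilinear form on real polynomials ⟨p,q⟩ = ∫_{−1}^{1} p(x)q(x)(1−x²)^{α−2} dx + M0( p(−1)q(−1) + p(1)q(1) ) + M1( p(−1)q′(−1) − p(1)q′(1) ), and assume it admits a sequence (q_n)_{n≥0} of left orthogonal polynomials. Then there exist real polynomials f_0, …, f_{2α+2} with deg f_j ≤ j and f_{2α+2} ≠ 0, and real numbers λ_n, such that Σ_{j=0}^{2α+2} f_j·q_n^{(j)} = λ_n·q_n for all n ≥ 0; that is, the q_n are eigenfunctions of a differential operator of order 2α+2. -/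
open Polynomial


/-- The discrete Gegenbauer–Sobolev bilinear form of Example 3.2 of the paper. -/
noncomputable def exBilin (α : ℕ) (M0 M1 : ℝ) (p q : Polynomial ℝ) : ℝ :=
  (∫ x in Set.Ioo (-1 : ℝ) 1, p.eval x * q.eval x * (1 - x ^ 2) ^ (α - 2)) +
    M0 * (p.eval (-1) * q.eval (-1) + p.eval 1 * q.eval 1) +
    M1 * (p.eval (-1) * (Polynomial.derivative q).eval (-1) -
      p.eval 1 * (Polynomial.derivative q).eval 1)

namespace GS

/-- integral over [-1,1] -/
noncomputable def I (p : ℝ[X]) : ℝ := ∫ x in Set.Ioo (-1 : ℝ) 1, p.eval x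

lemma I_eq (p : ℝ[X]) : I p = ∫ x in (-1:ℝ)..1, p.eval x := by
  rw [I, intervalIntegral.integral_of_le (by norm_num), MeasureTheory.integral_Ioc_eq_integral_Ioo]

lemma ii (p : ℝ[X]) : IntervalIntegrable (fun x => p.eval x) MeasureTheory.volume (-1:ℝ) 1 :=
  p.continuous.intervalIntegrable _ _

lemma I_add (p q : ℝ[X]) : I (p + q) = I p + I q := by
  simp only [I_eq, eval_add]
  exact intervalIntegral.integral_add (ii p) (ii q)

lemma I_Cmul (c : ℝ) (p : ℝ[X]) : I (C c * p) = c * I p := by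
  simp only [I_eq, eval_mul, eval_C]
  exact intervalIntegral.integral_const_mul _ _

lemma I_neg (p : ℝ[X]) : I (-p) = - I p := by
  have := I_Cmul (-1) p
  simpa using this

lemma I_sub (p q : ℝ[X]) : I (p - q) = I p - I q := by
  rw [sub_eq_add_neg, I_add, I_neg]; ring

lemma I_deriv (p : ℝ[X]) : I (derivative p) = p.eval 1 - p.eval (-1) := by
  rw [I_eq]
  exact intervalIntegral.integral_eq_sub_of_hasDerivAt (fun x _ => p.hasDerivAt x) (ii _)

lemma ibp (N : ℕ) : ∀ Y Z : ℝ[X], I (derivative^[N] Y * Z) =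
    (-1)^N * I (Y * derivative^[N] Z) +
    ((∑ i ∈ Finset.range N, (-1)^i * (derivative^[N-1-i] Y * derivative^[i] Z)).eval 1 -
     (∑ i ∈ Finset.range N, (-1)^i * (derivative^[N-1-i] Y * derivative^[i] Z)).eval (-1)) := by
  induction N with
  | zero => intro Y Z; simp
  | succ N ih =>
    intro Y Z
    have h1 := ih (derivative Y) Z
    have h2 : I (derivative Y * derivative^[N] Z) = (Y * derivative^[N] Z).eval 1
        - (Y * derivative^[N] Z).eval (-1) - I (Y * derivative^[N+1] Z) := by
      rw [← I_deriv, ← I_sub, Function.iterate_succ_apply']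
      congr 1
      rw [derivative_mul]; ring
    have h3 : ∀ i ∈ Finset.range N, ((-1:ℝ[X])^i * (derivative^[N+1-1-i] Y * derivative^[i] Z))
        = (-1)^i * (derivative^[N-1-i] (derivative Y) * derivative^[i] Z) := by
      intro i hi
      have : N + 1 - 1 - i = (N-1-i)+1 := by have := Finset.mem_range.1 hi; omega
      rw [this, Function.iterate_succ_apply]
    rw [Function.iterate_succ_apply, h1, h2, Finset.sum_range_succ, Finset.sum_congr rfl h3]
    simp only [eval_add, eval_mul, eval_pow, eval_neg, eval_one, Nat.add_sub_cancel, Nat.sub_self, Function.iterate_zero, id]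
    ring

/-- integer degree bound -/
def DegB (p : ℝ[X]) (m : ℤ) : Prop := ∀ i : ℕ, m < i → p.coeff i = 0

lemma DegB.mono {p : ℝ[X]} {m n : ℤ} (h : DegB p m) (hmn : m ≤ n) : DegB p n :=
  fun i hi => h i (lt_of_le_of_lt hmn hi)
lemma DegB.add {p q : ℝ[X]} {m : ℤ} (h : DegB p m) (h' : DegB q m) : DegB (p+q) m :=
  fun i hi => by rw [coeff_add, h i hi, h' i hi, add_zero]
lemma DegB.sub {p q : ℝ[X]} {m : ℤ} (h : DegB p m) (h' : DegB q m) : DegB (p-q) m :=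
  fun i hi => by rw [coeff_sub, h i hi, h' i hi, sub_zero]
lemma DegB.zero (m : ℤ) : DegB 0 m := fun i _ => by simp
lemma DegB.mul {p q : ℝ[X]} {m n k : ℤ} (h : DegB p m) (h' : DegB q n) (hk : m + n ≤ k) :
    DegB (p*q) k := by
  intro i hi
  rw [coeff_mul]
  apply Finset.sum_eq_zero
  intro x hx
  have hx' := Finset.HasAntidiagonal.mem_antidiagonal.1 hx
  by_cases h1 : m < x.1
  · rw [h _ h1, zero_mul]
  · rw [h' _ (by omega), mul_zero]
lemma DegB.C (c : ℝ) : DegB (Polynomial.C c) 0 := by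
  intro i hi
  rw [coeff_C]; rw [if_neg]; omega
lemma DegB.X : DegB (Polynomial.X : ℝ[X]) 1 := by
  intro i hi
  rw [coeff_X]; rw [if_neg]; omega
lemma DegB.pow {p : ℝ[X]} {m : ℤ} (h : DegB p m) (n : ℕ) : DegB (p^n) (n*m) := by
  induction n with
  | zero => simpa using DegB.C 1
  | succ n ih => rw [pow_succ]; exact ih.mul h (by push_cast; linarith)
lemma DegB.deriv {p : ℝ[X]} {m n : ℤ} (h : DegB p m) (hn : m - 1 ≤ n) : DegB (derivative p) n := by
  intro i hi
  rw [coeff_derivative, h (i+1) (by push_cast; omega), zero_mul]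
lemma DegB.iter {p : ℝ[X]} {m : ℤ} (h : DegB p m) (N : ℕ) : DegB (derivative^[N] p) (m-N) := by
  induction N with
  | zero => simpa using h
  | succ n ih => rw [Function.iterate_succ_apply']; exact ih.deriv (by push_cast; linarith)
lemma DegB.iff_le {p : ℝ[X]} {n : ℕ} : DegB p n ↔ p.degree ≤ (n:ℕ) := by
  rw [degree_le_iff_coeff_zero]
  constructor
  · intro h i hi; exact h i (by exact_mod_cast hi)
  · intro h i hi; exact h i (by exact_mod_cast hi)
lemma DegB.iff_lt {p : ℝ[X]} {n : ℕ} : DegB p (n-1) ↔ p.degree < (n:ℕ) := by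
  rw [degree_lt_iff_coeff_zero]
  constructor
  · intro h i hi; exact h i (by omega)
  · intro h i hi; exact h i (by omega)

/-- differential operator representation -/
def Rep (T : ℝ[X] → ℝ[X]) (N : ℕ) (s : ℤ) (g : ℝ[X]) : Prop :=
  ∃ f : ℕ → ℝ[X], (∀ j : ℕ, DegB (f j) (j+s)) ∧ f N = g ∧ (∀ j, N < j → f j = 0) ∧
    ∀ p, T p = ∑ j ∈ Finset.range (N+1), f j * derivative^[j] p

lemma Rep.mul {T N s g} (h : Rep T N s g) {u : ℝ[X]} {m k : ℤ} (hu : DegB u m) (hk : m + s ≤ k) :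
    Rep (fun p => u * T p) N k (u*g) := by
  obtain ⟨f, h1, h2, h3, h4⟩ := h
  refine ⟨fun j => u * f j, fun j => hu.mul (h1 j) (by linarith), by dsimp only; rw [h2],
    fun j hj => by dsimp only; rw [h3 j hj, mul_zero], fun p => ?_⟩
  dsimp only
  rw [h4, Finset.mul_sum]
  exact Finset.sum_congr rfl fun j _ => by ring

lemma Rep.deriv {T N s g} (h : Rep T N s g) {k : ℤ} (hk : s - 1 ≤ k) :
    Rep (fun p => derivative (T p)) (N+1) k g := by
  obtain ⟨f, h1, h2, h3, h4⟩ := h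
  refine ⟨fun j => derivative (f j) + (if j = 0 then 0 else f (j-1)), ?_, ?_, ?_, ?_⟩
  · intro j
    refine ((h1 j).deriv (by linarith)).add ?_
    split_ifs with hj
    · exact DegB.zero _
    · exact (h1 (j-1)).mono (by omega)
  · simp [h3 (N+1) (by omega), h2]
  · intro j hj
    simp [h3 j (by omega), h3 (j-1) (by omega)]
  · intro p
    dsimp only
    rw [h4, derivative_sum]
    simp only [derivative_mul, add_mul, Finset.sum_add_distrib]
    congr 1
    · rw [Finset.sum_range_succ _ (N+1), h3 (N+1) (by omega)]; simp
    · rw [Finset.sum_range_succ' _ (N+1)]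
      simp [Function.iterate_succ_apply']

lemma Rep.iter {T N s g} (h : Rep T N s g) (n : ℕ) :
    Rep (fun p => derivative^[n] (T p)) (N+n) (s-n) g := by
  induction n with
  | zero => simpa using h
  | succ n ih =>
    simp only [Function.iterate_succ_apply']
    exact ih.deriv (by push_cast; linarith)

lemma Rep.pad {T N s g} (h : Rep T N s g) {N' : ℕ} (hN : N < N') : Rep T N' s 0 := by
  obtain ⟨f, h1, h2, h3, h4⟩ := h
  refine ⟨f, h1, h3 _ hN, fun j hj => h3 j (by omega), fun p => ?_⟩
  rw [h4]
  apply Finset.sum_subset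
  · intro x; simp; omega
  · intro x _ hx
    rw [h3 x (by simpa using hx), zero_mul]

lemma Rep.add {T T' N s g g'} (h : Rep T N s g) (h' : Rep T' N s g') :
    Rep (fun p => T p + T' p) N s (g+g') := by
  obtain ⟨f, h1, h2, h3, h4⟩ := h
  obtain ⟨f', h1', h2', h3', h4'⟩ := h'
  refine ⟨fun j => f j + f' j, fun j => (h1 j).add (h1' j), by dsimp only; rw [h2, h2'],
    fun j hj => by dsimp only; rw [h3 j hj, h3' j hj, add_zero], fun p => ?_⟩
  dsimp only
  rw [h4, h4', ← Finset.sum_add_distrib]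
  exact Finset.sum_congr rfl fun j _ => by ring

lemma Rep.id : Rep (fun p => p) 0 0 1 :=
  ⟨fun j => if j = 0 then 1 else 0, fun j => by
    dsimp only
    split_ifs with h
    · simpa [h] using DegB.C 1
    · exact DegB.zero _, by simp, fun j hj => by simp; omega, fun p => by simp⟩

lemma Rep.degB {T g} {N : ℕ} {s : ℤ} (h : Rep T N s g) {p : ℝ[X]} {m : ℤ} (hp : DegB p m) :
    DegB (T p) (m+s) := by
  obtain ⟨f, h1, h2, h3, h4⟩ := h
  rw [h4]
  refine Finset.sum_induction _ (fun q => DegB q (m+s)) (fun _ _ h h' => h.add h') (DegB.zero _) ?_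
  intro j _
  exact (h1 j).mul (hp.iter j) (by linarith)

lemma eval_iter (ε : ℝ) (P : ℝ[X]) (k : ℕ) :
    (derivative^[k] P).eval ε = k.factorial * (taylor ε P).coeff k := by
  rw [taylor_coeff, ← factorial_smul_hasseDeriv]
  simp

lemma taylor_deriv (ε : ℝ) (P : ℝ[X]) : taylor ε (derivative P) = derivative (taylor ε P) := by
  simp [taylor_apply, derivative_comp]

lemma coeff_mul_two (A B : ℝ[X]) : (A*B).coeff 2 =
    A.coeff 0 * B.coeff 2 + A.coeff 1 * B.coeff 1 + A.coeff 2 * B.coeff 0 := by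
  simp [coeff_mul, Finset.Nat.antidiagonal_succ]; ring

/-- the polynomial `x² - 1` -/
noncomputable def v : ℝ[X] := X^2 - 1

noncomputable def Jp (a : ℕ) (p : ℝ[X]) : ℝ[X] :=
  v * derivative (derivative p) + C (2*a+2 : ℝ) * X * derivative p

noncomputable def Eop (a : ℕ) (c : ℝ) (p : ℝ[X]) : ℝ[X] :=
  v^2 * derivative (derivative p) + C (2*a+2 : ℝ) * X * v * derivative p
    + C c * v * p - C (8*(a+2) : ℝ) * p

noncomputable def Dop (a : ℕ) (c k : ℝ) (p : ℝ[X]) : ℝ[X] :=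
  v * derivative^[2*a+4] (v^a * Eop a c p) + C k * Jp a p

noncomputable def Dst (a : ℕ) (c k : ℝ) (r : ℝ[X]) : ℝ[X] :=
  Jp a (v * derivative^[2*a+4] (v^(a+1) * r)) + C c * (v * derivative^[2*a+4] (v^(a+1) * r))
   - C (8*(a+2) : ℝ) * derivative^[2*a+4] (v^(a+1) * r) + C k * Jp a r

lemma taylor_v (ε : ℝ) (hε : ε = 1 ∨ ε = -1) : taylor ε v = X * (X + C (2*ε)) := by
  have : ε^2 = 1 := by rcases hε with rfl | rfl <;> norm_num
  have h2 : (C ε : ℝ[X])^2 = 1 := by rw [← C_pow, this, C_1]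
  simp only [v, taylor_apply, sub_comp, pow_comp, X_comp, one_comp, C_mul]
  have h3 : (C 2 : ℝ[X]) = 2 := rfl
  rw [h3]
  linear_combination h2

lemma pow_coeffs (a : ℕ) (ε : ℝ) (hε : ε = 1 ∨ ε = -1) :
    ((X + C (2*ε) : ℝ[X])^a).coeff 0 = (2*ε)^a ∧
    ((X + C (2*ε) : ℝ[X])^a).coeff 1 = a*ε/2 * (2*ε)^a ∧
    ((X + C (2*ε) : ℝ[X])^a).coeff 2 = a*(a-1)/8 * (2*ε)^a := by
  have h0 : ((X + C (2*ε) : ℝ[X])^a).coeff 0 = (2*ε)^a := by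
    rw [coeff_zero_eq_eval_zero]; simp
  set A := (X + C (2*ε) : ℝ[X])^a with hA
  have hd : X * derivative A + C (2*ε) * derivative A = C (a:ℝ) * A := by
    rw [hA, derivative_pow]
    cases a with
    | zero => simp
    | succ n => simp; ring
  have e0 := congrArg (fun P => coeff P 0) hd
  have e1 := congrArg (fun P => coeff P 1) hd
  simp only [coeff_add, coeff_C_mul, coeff_derivative, coeff_X_mul, coeff_X_mul_zero] at e0 e1
  norm_num at e0 e1
  refine ⟨h0, ?_, ?_⟩
  · rw [← h0]
    rcases hε with rfl | rfl <;> linarith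
  · have h1 : A.coeff 1 = a*ε/2 * A.coeff 0 := by rcases hε with rfl | rfl <;> linarith
    rw [← h0]
    rw [h1] at e1
    rcases hε with rfl | rfl
    · linear_combination e1/4
    · linear_combination -e1/4

lemma E_coeffs (a : ℕ) (c ε : ℝ) (hε : ε = 1 ∨ ε = -1) (p : ℝ[X]) :
    (taylor ε (Eop a c p)).coeff 0 = -8*(a+2) * (taylor ε p).coeff 0 ∧
    (taylor ε (Eop a c p)).coeff 1 = -(4*a+12) * (taylor ε p).coeff 1 + 2*ε*c*(taylor ε p).coeff 0 ∧
    (taylor ε (Eop a c p)).coeff 2 = ((6*a+6)*ε + 2*ε*c) * (taylor ε p).coeff 1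
      + c*(taylor ε p).coeff 0 := by
  have hX : taylor ε (X : ℝ[X]) = X + C ε := by simp [taylor_apply]
  have hc : ∀ y : ℝ, taylor ε (C y : ℝ[X]) = C y := by intro y; simp
  have e2 : ε^2 = 1 := by rcases hε with rfl | rfl <;> norm_num
  have h2 : (C ε : ℝ[X])^2 = 1 := by rw [← C_pow, e2, C_1]
  have hC2 : (C (2*ε) : ℝ[X]) = 2 * C ε := by rw [C_mul]; rfl
  have key : taylor ε (Eop a c p) =
      X^4 * derivative (derivative (taylor ε p)) + X^3 * (C (4*ε) * derivative (derivative (taylor ε p)))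
      + X^2 * (C 4 * derivative (derivative (taylor ε p)))
      + X^3 * (C (2*a+2:ℝ) * derivative (taylor ε p))
      + X^2 * (C (3*ε*(2*a+2:ℝ)) * derivative (taylor ε p))
      + X^1 * (C (2*(2*a+2:ℝ)) * derivative (taylor ε p))
      + X^2 * (C c * taylor ε p) + X^1 * (C (2*ε*c) * taylor ε p)
      - C (8*(a+2) : ℝ) * taylor ε p := by
    simp only [Eop, map_add, map_sub, taylor_mul, taylor_pow, taylor_v ε hε, taylor_deriv, hX, hc]
    simp only [C_mul, C_add]
    have h3 : (C 2 : ℝ[X]) = 2 := rfl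
    have h4 : (C 4 : ℝ[X]) = 4 := rfl
    have h5 : (C 3 : ℝ[X]) = 3 := rfl
    rw [h3, h4, h5]
    set Q := derivative (derivative (taylor ε p))
    set Q1 := derivative (taylor ε p)
    linear_combination (4*X^2*Q + 2*X*(2*C (a:ℝ)+2)*Q1) * h2
  rw [key]
  refine ⟨?_, ?_, ?_⟩ <;>
  · simp only [coeff_add, coeff_sub, coeff_C_mul, coeff_X_pow_mul', coeff_derivative]
    norm_num
    try ring

lemma sum3 (a : ℕ) (F : ℕ → ℝ) (h1 : ∀ i < a+1, F i = 0) (h2 : ∀ i, a+4 ≤ i → i < 2*a+4 → F i = 0) :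
    ∑ i ∈ Finset.range (2*a+4), F i = F (a+1) + F (a+2) + F (a+3) := by
  have : 2*a+4 = (a+1)+(3+a) := by ring
  rw [this, Finset.sum_range_add, Finset.sum_range_add _ 3 a]
  rw [Finset.sum_eq_zero (fun i hi => h1 i (Finset.mem_range.1 hi)),
    Finset.sum_eq_zero (s := Finset.range a) (fun i hi => h2 _ (by omega) (by
      have := Finset.mem_range.1 hi; omega))]
  simp [Finset.sum_range_succ, add_assoc]

lemma bdry (a : ℕ) (μ ε : ℝ) (hε : ε = 1 ∨ ε = -1) (p r : ℝ[X]) (c : ℝ)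
    (hc : c = -(4*a+6) - (2*a+6)*μ) :
    (∑ i ∈ Finset.range (2*a+4), (-1)^i * (derivative^[2*a+4-1-i] (v^a * Eop a c p) *
      derivative^[i] (v^(a+1) * r))).eval ε =
    (-1)^a * ε * (4^(a+1) * a.factorial * (a+3).factorial) *
      (ε*(2*a+2)*(taylor ε p).coeff 1 * (μ * (taylor ε r).coeff 0 - ε * (taylor ε r).coeff 1)
        - (taylor ε p).coeff 0 * (μ*ε*(2*a+2) * (taylor ε r).coeff 1
          - ε*(ε*(4*a+8)*(taylor ε r).coeff 2 + (2*a+2)*(taylor ε r).coeff 1))) := by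
  set A := (X + C (2*ε) : ℝ[X])^a with hA
  obtain ⟨hA0, hA1, hA2⟩ := pow_coeffs a ε hε
  obtain ⟨hE0, hE1, hE2⟩ := E_coeffs a c ε hε p
  rw [← hA] at hA0 hA1 hA2
  have hY : taylor ε (v^a * Eop a c p) = X^a * (A * taylor ε (Eop a c p)) := by
    rw [taylor_mul, taylor_pow, taylor_v ε hε, mul_pow, mul_assoc]
  have hZ : taylor ε (v^(a+1) * r) = X^(a+1) * (X * (A * taylor ε r) + C (2*ε) * (A * taylor ε r)) := by
    rw [taylor_mul, taylor_pow, taylor_v ε hε, mul_pow, pow_succ (X + C (2*ε))]; ring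
  have cY : ∀ j, (derivative^[a+j] (v^a * Eop a c p)).eval ε =
      (a+j).factorial * (A * taylor ε (Eop a c p)).coeff j := by
    intro j
    rw [eval_iter, hY, add_comm a j, coeff_X_pow_mul]
  have cZ : ∀ j, (derivative^[a+1+j] (v^(a+1) * r)).eval ε =
      (a+1+j).factorial * (X * (A * taylor ε r) + C (2*ε) * (A * taylor ε r)).coeff j := by
    intro j
    rw [eval_iter, hZ, add_comm (a+1) j, coeff_X_pow_mul]
  have zY : ∀ j < a, (derivative^[j] (v^a * Eop a c p)).eval ε = 0 := by
    intro j hj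
    rw [eval_iter, hY, coeff_X_pow_mul', if_neg (by omega), mul_zero]
  have zZ : ∀ j < a+1, (derivative^[j] (v^(a+1) * r)).eval ε = 0 := by
    intro j hj
    rw [eval_iter, hZ, coeff_X_pow_mul', if_neg (by omega), mul_zero]
  rw [eval_finsetSum, sum3]
  · have i1 : 2*a+4-1-(a+1) = a+2 := by omega
    have i2 : 2*a+4-1-(a+2) = a+1 := by omega
    have i3 : 2*a+4-1-(a+3) = a+0 := by omega
    rw [i1, i2, i3]
    simp only [eval_mul, eval_pow, eval_neg, eval_one, cY]
    have c0 := cZ 0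
    have c1 := cZ 1
    have c2 := cZ 2
    rw [show a+1+0 = a+1 by ring] at c0
    rw [show a+1+1 = a+2 by ring] at c1
    rw [show a+1+2 = a+3 by ring] at c2
    rw [c0, c1, c2]
    have y0 : (A * taylor ε (Eop a c p)).coeff 0 = _ := mul_coeff_zero _ _
    have y1 : (A * taylor ε (Eop a c p)).coeff 1 = _ := mul_coeff_one _ _
    have y2 : (A * taylor ε (Eop a c p)).coeff 2 = _ := coeff_mul_two _ _
    have z0 : (X * (A * taylor ε r) + C (2*ε) * (A * taylor ε r)).coeff 0 =
        2 * ε * (A.coeff 0 * (taylor ε r).coeff 0) := by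
      rw [coeff_add, coeff_C_mul, coeff_X_mul_zero, mul_coeff_zero, zero_add]
    have z1 : (X * (A * taylor ε r) + C (2*ε) * (A * taylor ε r)).coeff 1 =
        A.coeff 0 * (taylor ε r).coeff 0 + 2 * ε * (A.coeff 0 * (taylor ε r).coeff 1
          + A.coeff 1 * (taylor ε r).coeff 0) := by
      rw [coeff_add, coeff_C_mul, coeff_X_mul _ 0, mul_coeff_zero, mul_coeff_one]
    have z2 : (X * (A * taylor ε r) + C (2*ε) * (A * taylor ε r)).coeff 2 =
        (A.coeff 0 * (taylor ε r).coeff 1 + A.coeff 1 * (taylor ε r).coeff 0)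
        + 2 * ε * (A.coeff 0 * (taylor ε r).coeff 2 + A.coeff 1 * (taylor ε r).coeff 1
          + A.coeff 2 * (taylor ε r).coeff 0) := by
      rw [coeff_add, coeff_C_mul, coeff_X_mul _ 1, mul_coeff_one, coeff_mul_two]
    rw [y0, y1, y2, z0, z1, z2, hE0, hE1, hE2, hA0, hA1, hA2, hc]
    have f1 : ((a+1).factorial : ℝ) = (a+1) * a.factorial := by rw [Nat.factorial_succ]; push_cast; ring
    have f2 : ((a+2).factorial : ℝ) = (a+2) * (a+1) * a.factorial := by
      rw [Nat.factorial_succ, Nat.factorial_succ]; push_cast; ring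
    have f3 : ((a+3).factorial : ℝ) = (a+3) * (a+2) * (a+1) * a.factorial := by
      rw [Nat.factorial_succ, Nat.factorial_succ, Nat.factorial_succ]; push_cast; ring
    have h4 : (4:ℝ)^(a+1) = 4 * ((2*ε)^a * (2*ε)^a) := by
      rw [← mul_pow, pow_succ]
      rcases hε with rfl | rfl <;> norm_num <;> ring
    rw [h4, add_zero a, f1, f2, f3, pow_succ, pow_add (-1:ℝ) a 2, pow_add (-1:ℝ) a 3]
    generalize (2*ε)^a = B
    generalize (-1:ℝ)^a = S
    generalize (a.factorial:ℝ) = f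
    rcases hε with rfl | rfl <;> ring
  · intro i hi
    simp [zZ i hi]
  · intro i hi hi'
    have := zY (2*a+4-1-i) (by omega)
    rw [eval_mul, eval_mul, this, zero_mul, mul_zero]

lemma v_eval (ε : ℝ) (hε : ε = 1 ∨ ε = -1) : v.eval ε = 0 := by
  rcases hε with rfl | rfl <;> simp [v]

lemma v_deriv : derivative v = 2 * X := by simp [v]; norm_num

lemma green (a : ℕ) (p u : ℝ[X]) : I (v^a * Jp a p * u) = I (p * (v^a * Jp a u)) := by
  rw [← sub_eq_zero, ← I_sub]
  have : v^a * Jp a p * u - p * (v^a * Jp a u) =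
      derivative (v^(a+1) * (derivative p * u - p * derivative u)) := by
    simp only [Jp, derivative_mul, derivative_pow_succ, derivative_sub, v_deriv, C_add, C_mul]
    have h3 : (C 2 : ℝ[X]) = 2 := rfl
    rw [h3]
    simp
    ring
  rw [this, I_deriv]
  simp [v_eval]

lemma tc0 (ε : ℝ) (p : ℝ[X]) : (taylor ε p).coeff 0 = p.eval ε := by simp
lemma tc1 (ε : ℝ) (p : ℝ[X]) : (taylor ε p).coeff 1 = (derivative p).eval ε := by simp
lemma tc2 (ε : ℝ) (p : ℝ[X]) : (taylor ε p).coeff 2 = (derivative (derivative p)).eval ε / 2 := by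
  have := eval_iter ε p 2
  simp [Nat.factorial] at this
  rw [this]; ring

/-- boundary functional -/
lemma bform (a : ℕ) (M0 M1 c k : ℝ) (ε : ℝ) (hε : ε = 1 ∨ ε = -1) (p r : ℝ[X])
    (hM1 : M1 ≠ 0) (μ : ℝ) (hμ : M0 = μ * M1) (hc : c = -(4*a+6) - (2*a+6)*μ)
    (hk : k * M1 = -(4^(a+1) * a.factorial * (a+3).factorial)) :
    (-1)^a * ε * (∑ i ∈ Finset.range (2*a+4), (-1)^i * (derivative^[2*a+4-1-i] (v^a * Eop a c p) *
      derivative^[i] (v^(a+1) * r))).eval ε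
     + (Dop a c k p).eval ε * (M0 * r.eval ε - ε * M1 * (derivative r).eval ε)
     = p.eval ε * (M0 * (Dst a c k r).eval ε - ε * M1 * (derivative (Dst a c k r)).eval ε) := by
  rw [bdry a μ ε hε p r c hc, tc0, tc0, tc1, tc1, tc2]
  have hS : ((-1:ℝ)^a) * (-1)^a = 1 := by rw [← mul_pow]; norm_num
  set R := derivative^[2*a+4] (v^(a+1) * r) with hR
  have e1 : (Dop a c k p).eval ε = k * (ε * (2*a+2) * (derivative p).eval ε) := by
    simp only [Dop, Jp, eval_add, eval_mul, eval_C, eval_X, v_eval ε hε]; ring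
  have e2 : (Dst a c k r).eval ε = -(4*a+12) * R.eval ε + k * (ε * (2*a+2) * (derivative r).eval ε) := by
    simp only [Dst, Jp, ← hR]
    simp [v_eval ε hε, v_deriv]
    rcases hε with rfl | rfl <;> ring
  have e3 : (derivative (Dst a c k r)).eval ε = ε * (8*a+12+2*c) * R.eval ε
      + k * (ε * (2*a+4) * (derivative (derivative r)).eval ε + (2*a+2) * (derivative r).eval ε) := by
    simp only [Dst, Jp, ← hR]
    simp [v_eval ε hε, v_deriv]
    rcases hε with rfl | rfl <;> ring
  rw [e1, e2, e3, hμ, hc]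
  have hk' : 4^(a+1) * (a.factorial:ℝ) * (a+3).factorial = -(k*M1) := by linarith
  rw [hk']
  generalize (-1:ℝ)^a = S at *
  have e : ε * ε = 1 := by rcases hε with rfl | rfl <;> norm_num
  rcases hε with rfl | rfl
  · linear_combination (-(k*M1) * ((1:ℝ)*(2*a+2)*(derivative p).eval (1:ℝ) * (μ * r.eval (1:ℝ) - (1:ℝ) * (derivative r).eval (1:ℝ))
        - p.eval (1:ℝ) * (μ*(1:ℝ)*(2*a+2) * (derivative r).eval (1:ℝ)
          - (1:ℝ)*((1:ℝ)*(4*a+8)*((derivative (derivative r)).eval (1:ℝ)/2) + (2*a+2)*(derivative r).eval (1:ℝ))))) * hS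
  · linear_combination (-(k*M1) * ((-1:ℝ)*(2*a+2)*(derivative p).eval (-1:ℝ) * (μ * r.eval (-1:ℝ) - (-1:ℝ) * (derivative r).eval (-1:ℝ))
        - p.eval (-1:ℝ) * (μ*(-1:ℝ)*(2*a+2) * (derivative r).eval (-1:ℝ)
          - (-1:ℝ)*((-1:ℝ)*(4*a+8)*((derivative (derivative r)).eval (-1:ℝ)/2) + (2*a+2)*(derivative r).eval (-1:ℝ))))) * hS

lemma degB_v : DegB v 2 := by
  have := (DegB.X.pow 2).sub ((DegB.C 1).mono (n := ((2:ℕ):ℤ)*1) (by norm_num))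
  simpa [v] using this

lemma rep_Jp (a : ℕ) : Rep (Jp a) 2 0 v := by
  have h1 := ((Rep.id.deriv (k := -1) (by norm_num)).deriv (k := -2) (by norm_num)).mul degB_v
    (k := 0) (by norm_num)
  have h2 := ((Rep.id.deriv (k := -1) (by norm_num)).mul
    ((DegB.C (2*a+2 : ℝ)).mul DegB.X (k := 1) (by norm_num)) (k := 0) (by norm_num)).pad
    (N' := 2) (by norm_num)
  have h3 : Rep (Jp a) 2 0 (v*1+0) := h1.add h2
  simpa only [mul_one, add_zero] using h3

lemma rep_Eop (a : ℕ) (c : ℝ) : Rep (Eop a c) 2 2 (v^2) := by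
  have h1 := (rep_Jp a).mul degB_v (k := 2) (by norm_num)
  have h2 := ((Rep.id.mul ((DegB.C c).mul degB_v (k := 2) (by norm_num)) (k := 2) (by norm_num)).add
    (Rep.id.mul ((DegB.C (-(8*(a+2)) : ℝ)).mono (n := 2) (by norm_num)) (k := 2) (by norm_num))).pad
    (N' := 2) (by norm_num)
  have := h1.add h2
  have e : (fun p => v * Jp a p + (C c * v * p + C (-(8*(a+2)) : ℝ) * p)) = Eop a c := by
    funext p
    simp only [Jp, Eop, C_neg]; ring
  rw [e] at this
  convert this using 1
  ring

lemma rep_Dop (a : ℕ) (c k : ℝ) : Rep (Dop a c k) (2*a+6) 0 (v^(a+3)) := by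
  have h1 := (((rep_Eop a c).mul (degB_v.pow a) (k := 2*a+2) (by linarith)).iter (2*a+4)).mul degB_v
    (k := 0) (by push_cast; linarith)
  have h2 := ((rep_Jp a).mul (DegB.C k) (k := 0) (by norm_num)).pad (N' := 2+(2*a+4)) (by omega)
  have h3 : Rep (Dop a c k) (2+(2*a+4)) 0 (v*(v^a*v^2)+0) := h1.add h2
  have e1 : 2 + (2*a+4) = 2*a+6 := by ring
  have e2 : v*(v^a*v^2)+0 = v^(a+3) := by ring
  rwa [e1, e2] at h3

lemma degB_Dst (a : ℕ) (c k : ℝ) {r : ℝ[X]} {m : ℤ} (h : DegB r m) : DegB (Dst a c k r) m := by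
  have hR : DegB (derivative^[2*a+4] (v^(a+1) * r)) (m-2) :=
    (((degB_v.pow (a+1)).mul h le_rfl).iter (2*a+4)).mono (by push_cast; linarith)
  have hv : DegB (v * derivative^[2*a+4] (v^(a+1) * r)) m := degB_v.mul hR (by linarith)
  have j1 := (rep_Jp a).degB hv
  have j2 := (rep_Jp a).degB h
  rw [add_zero] at j1 j2
  exact ((j1.add ((DegB.C c).mul hv (by linarith))).sub
    ((DegB.C _).mul hR (by linarith))).add ((DegB.C k).mul j2 (by linarith))


lemma exB (a : ℕ) (M0 M1 : ℝ) (p r : ℝ[X]) : exBilin (a+2) M0 M1 p r =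
    (-1)^a * I (v^a * p * r) + p.eval 1 * (M0 * r.eval 1 - 1 * M1 * (derivative r).eval 1)
     + p.eval (-1) * (M0 * r.eval (-1) - (-1) * M1 * (derivative r).eval (-1)) := by
  rw [← I_Cmul, exBilin, I]
  have : ∀ x : ℝ, p.eval x * r.eval x * (1 - x^2)^(a+2-2) =
      (C ((-1)^a) * (v^a * p * r)).eval x := by
    intro x
    simp only [v, eval_mul, eval_C, eval_pow, eval_sub, eval_X, eval_one, Nat.add_sub_cancel]
    rw [show (1 - x^2) = (-1) * (x^2-1) by ring, mul_pow]; ring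
  simp only [this]
  ring

lemma adj (a : ℕ) (M0 M1 c k μ : ℝ) (p r : ℝ[X])
    (hM1 : M1 ≠ 0) (hμ : M0 = μ * M1) (hc : c = -(4*a+6) - (2*a+6)*μ)
    (hk : k * M1 = -(4^(a+1) * a.factorial * (a+3).factorial)) :
    exBilin (a+2) M0 M1 (Dop a c k p) r = exBilin (a+2) M0 M1 p (Dst a c k r) := by
  rw [exB, exB]
  have b1 := bform a M0 M1 c k 1 (Or.inl rfl) p r hM1 μ hμ hc hk
  have b2 := bform a M0 M1 c k (-1) (Or.inr rfl) p r hM1 μ hμ hc hk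
  have h := ibp (2*a+4) (v^a * Eop a c p) (v^(a+1) * r)
  have hs : ((-1:ℝ))^(2*a+4) = 1 := by
    rw [show 2*a+4 = 2*(a+2) by ring, pow_mul]; norm_num
  rw [hs, one_mul] at h
  set R := derivative^[2*a+4] (v^(a+1) * r) with hR
  have g1 := green a p (v * R)
  have g2 := green a p r
  have i1 : I (v^a * Dop a c k p * r) = I (derivative^[2*a+4] (v^a * Eop a c p) * (v^(a+1) * r))
      + k * I (v^a * Jp a p * r) := by
    rw [← I_Cmul, ← I_add]
    congr 1
    rw [Dop]; ring
  have i2 : I (v^a * Eop a c p * R) = I (v^a * Jp a p * (v*R))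
      + I (v^a * p * (C c * (v * R) - C (8*(a+2) : ℝ) * R)) := by
    rw [← I_add]
    congr 1
    rw [Eop, Jp]; ring
  have i3 : I (v^a * p * Dst a c k r) = I (p * (v^a * Jp a (v*R)))
      + I (v^a * p * (C c * (v * R) - C (8*(a+2) : ℝ) * R)) + k * I (p * (v^a * Jp a r)) := by
    rw [← I_Cmul, ← I_add, ← I_add]
    congr 1
    rw [Dst, ← hR]; ring
  rw [i1, i3, h, i2, g1, g2]
  linear_combination b1 + b2

lemma exB_sub (a : ℕ) (M0 M1 l : ℝ) (p q r : ℝ[X]) : exBilin (a+2) M0 M1 (p - C l * q) r =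
    exBilin (a+2) M0 M1 p r - l * exBilin (a+2) M0 M1 q r := by
  rw [exB, exB, exB]
  have : v^a * (p - C l * q) * r = v^a*p*r - C l * (v^a*q*r) := by ring
  rw [this, I_sub, I_Cmul]
  simp only [eval_sub, eval_mul, eval_C]
  ring

lemma lower {p q : ℝ[X]} {n : ℕ} (hp : DegB p n) (hq : q.degree = (n:ℕ)) :
    ∃ l : ℝ, (p - C l * q).degree < (n:ℕ) := by
  have hn : q.natDegree = n := natDegree_eq_of_degree_eq_some hq
  have h0 : q.coeff n ≠ 0 := by
    rw [← hn]
    have : q ≠ 0 := by rintro rfl; simp at hq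
    simpa using this
  refine ⟨p.coeff n / q.coeff n, ?_⟩
  rw [← DegB.iff_lt]
  intro i hi
  rw [coeff_sub, coeff_C_mul]
  rcases (show n ≤ i by omega).eq_or_lt with rfl | h
  · field_simp; ring
  · rw [hp i (by exact_mod_cast h), coeff_eq_zero_of_natDegree_lt (p := q) (n := i) (by rw [hn]; exact h)]; simp

lemma nondeg (a : ℕ) (M0 M1 : ℝ) (q : ℕ → ℝ[X]) (hq : IsLeftOrthoSeq (exBilin (a+2) M0 M1) q)
    (n : ℕ) : ∀ h : ℝ[X], h.degree < (n:ℕ) →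
      (∀ r : ℝ[X], r.degree < (n:ℕ) → exBilin (a+2) M0 M1 h r = 0) → h = 0 := by
  obtain ⟨h1, h2, h3⟩ := hq
  induction n with
  | zero => intro h hh _; simpa using hh
  | succ n ih =>
    intro h hh hr
    have hh' : DegB h n := by
      have := DegB.iff_lt.2 hh
      exact this.mono (by push_cast; linarith)
    obtain ⟨l, hl⟩ := lower hh' (h1 n)
    have h0 : h - C l * q n = 0 := by
      apply ih _ hl
      intro r hd
      rw [exB_sub, h2 n r hd, hr r (hd.trans (by exact_mod_cast Nat.lt_succ_self n))]
      ring
    have e := exB_sub a M0 M1 l h (q n) (q n)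
    rw [h0, hr (q n) (by rw [h1]; exact_mod_cast Nat.lt_succ_self n)] at e
    have z : exBilin (a+2) M0 M1 0 (q n) = 0 := by rw [exB]; simp [I]
    rw [z] at e
    have : l = 0 := by
      have : l * exBilin (a+2) M0 M1 (q n) (q n) = 0 := by linarith
      exact (mul_eq_zero.1 this).resolve_right (h3 n)
    rw [this] at h0
    simpa using h0

end GS

/-- **Example 3.2.** The left orthogonal polynomials of the bilinear form `exBilin` are
eigenfunctions of a differential operator of order `2α+2`. -/
theorem gegenbauer_sobolev_order (α : ℕ) (hα : 2 ≤ α) (M0 M1 : ℝ)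
    (hM1 : M1 ≠ 0) (hM01 : M0 ≠ M1)
    (q : ℕ → Polynomial ℝ) (hq : IsLeftOrthoSeq (exBilin α M0 M1) q) :
    ∃ f : ℕ → Polynomial ℝ,
      (∀ j ≤ 2 * α + 2, (f j).degree ≤ (j : ℕ)) ∧ f (2 * α + 2) ≠ 0 ∧
      ∃ lam : ℕ → ℝ, ∀ n : ℕ,
        ∑ j ∈ Finset.range (2 * α + 3), f j * (⇑Polynomial.derivative)^[j] (q n) =
          lam n • q n := by
  obtain ⟨a, rfl⟩ : ∃ a, α = a + 2 := ⟨α - 2, by omega⟩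
  set μ := M0 / M1 with hμd
  have hμ : M0 = μ * M1 := by rw [hμd]; field_simp
  set c : ℝ := -(4*a+6) - (2*a+6)*μ with hc
  set k : ℝ := -(4^(a+1) * a.factorial * (a+3).factorial) / M1 with hkd
  have hk : k * M1 = -(4^(a+1) * a.factorial * (a+3).factorial) := by rw [hkd]; field_simp
  have hD := GS.rep_Dop a c k
  have hdeg : ∀ n, GS.DegB (GS.Dop a c k (q n)) n := by
    intro n
    have := hD.degB (GS.DegB.iff_le.2 (hq.1 n).le)
    rwa [add_zero] at this
  have heig : ∀ n, ∃ l : ℝ, GS.Dop a c k (q n) = l • q n := by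
    intro n
    obtain ⟨l, hl⟩ := GS.lower (hdeg n) (hq.1 n)
    refine ⟨l, ?_⟩
    have := GS.nondeg a M0 M1 q hq n _ hl (by
      intro r hr
      have hr' : (GS.Dst a c k r).degree < (n:ℕ) :=
        GS.DegB.iff_lt.1 (GS.degB_Dst a c k (GS.DegB.iff_lt.2 hr))
      rw [GS.exB_sub, GS.adj a M0 M1 c k μ (q n) r hM1 hμ hc hk, hq.2.1 n _ hr', hq.2.1 n _ hr]
      ring)
    rw [smul_eq_C_mul]
    exact sub_eq_zero.1 this
  choose lam hlam using heig
  obtain ⟨f, f1, f2, f3, f4⟩ := hD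
  refine ⟨f, ?_, ?_, lam, ?_⟩
  · intro j _
    have := f1 j
    rw [add_zero] at this
    exact GS.DegB.iff_le.1 this
  · rw [show 2 * (a+2) + 2 = 2*a+6 by ring, f2]
    apply pow_ne_zero
    intro h
    have := congrArg (eval 0) h
    simp [GS.v] at this
  · intro n
    rw [← hlam n, f4, show 2 * (a+2) + 3 = 2*a+6+1 by ring]
end
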